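/- arXiv:1703.02134 — 2 statements merged into one kernel-verified Lean document; each statement's English description precedes it below -/
import Mathlib

section
/- (Firewall decrease up to pollution term, standing frame.) In the setting below, set ν = min(1/w, λ_min/(4(w·λ_max + 1/2))). Then there exists a nonnegative quantity K', depending only on V and on R (where sup over r,t of |u(r,t)| ≤ R), such that for every t > 0 the function F̃ is differentiable and F̃'(t) ≤ −ν F̃(t) + K' ∫_{Σ₀(t)} ψ̃(r,t) dr. -/
open Filter Topology Set MeasureTheory

noncomputable section

local notation "⟪" x ", " y "⟫" => @inner ℝ _ _ x y

abbrev Euc (n : ℕ) : Type := EuclideanSpace ℝ (Fin n)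

variable {n : ℕ}

/-- Spatial partial derivative `u_r`. -/
def ur (u : ℝ → ℝ → Euc n) (r t : ℝ) : Euc n := deriv (fun s => u s t) r

/-- Second spatial partial derivative `u_rr`. -/
def urr (u : ℝ → ℝ → Euc n) (r t : ℝ) : Euc n := deriv (fun s => ur u s t) r

/-- Time partial derivative `u_t`. -/
def ut (u : ℝ → ℝ → Euc n) (r t : ℝ) : Euc n := deriv (fun s => u r s) t

/-- Hessian (second differential) of the potential. -/
def hess (V : Euc n → ℝ) (x : Euc n) : Euc n →L[ℝ] Euc n := fderiv ℝ (gradient V) x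

/-- Coercivity hypothesis. -/
def HCoerc (V : Euc n → ℝ) : Prop :=
  ∃ ε > (0:ℝ), ∃ R : ℝ, ∀ x : Euc n, R ≤ ‖x‖ → ε * ‖x‖ ^ 2 ≤ ⟪x, gradient V x⟫

/-- The set of nondegenerate minimum points of `V`. -/
def MinSet (V : Euc n → ℝ) : Set (Euc n) :=
  {m | gradient V m = 0 ∧ ∀ v : Euc n, v ≠ 0 → 0 < ⟪v, hess V m v⟫}

/-- Data of the constants `λ_min`, `λ_max`, `d_Esc` from the paper, together with their
spectral characterizations. -/
structure EscData (n : ℕ) (V : Euc n → ℝ) where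
  lmin : ℝ
  lmax : ℝ
  dEsc : ℝ
  lmin_pos : 0 < lmin
  dEsc_pos : 0 < dEsc
  lower : ∀ m ∈ MinSet V, ∀ v : Euc n, lmin * ‖v‖ ^ 2 ≤ ⟪v, hess V m v⟫
  upper : ∀ m ∈ MinSet V, ∀ v : Euc n, ⟪v, hess V m v⟫ ≤ lmax * ‖v‖ ^ 2
  esc_lower : ∀ m ∈ MinSet V, ∀ x : Euc n, ‖x - m‖ ≤ dEsc →
    ∀ v : Euc n, lmin / 2 * ‖v‖ ^ 2 ≤ ⟪v, hess V x v⟫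
  esc_upper : ∀ m ∈ MinSet V, ∀ x : Euc n, ‖x - m‖ ≤ dEsc →
    ∀ v : Euc n, ⟪v, hess V x v⟫ ≤ 2 * lmax * ‖v‖ ^ 2

/-- Radially symmetric solution of `u_t = -∇V(u) + ((d-1)/r) u_r + u_rr` with Neumann
boundary condition at the origin. -/
structure IsRadialSolution (d : ℕ) (V : Euc n → ℝ) (u : ℝ → ℝ → Euc n) : Prop where
  diff_r : ∀ t > (0:ℝ), ∀ r : ℝ, DifferentiableAt ℝ (fun s => u s t) r
  diff_rr : ∀ t > (0:ℝ), ∀ r : ℝ, DifferentiableAt ℝ (fun s => ur u s t) r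
  cont_rr : ∀ t > (0:ℝ), Continuous fun r => urr u r t
  diff_t : ∀ t > (0:ℝ), ∀ r : ℝ, DifferentiableAt ℝ (fun s => u r s) t
  cont_t : ∀ r : ℝ, ContinuousOn (fun s => ut u r s) (Ioi 0)
  bounded : ∃ C : ℝ, ∀ r t : ℝ, 0 ≤ r → 0 < t →
    ‖u r t‖ + ‖ur u r t‖ + ‖urr u r t‖ + ‖ut u r t‖ ≤ C
  pde : ∀ r > (0:ℝ), ∀ t > (0:ℝ),
    ut u r t = -gradient V (u r t) + (((d : ℝ) - 1) / r) • ur u r t + urr u r t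
  neumann : ∀ t > (0:ℝ), ur u 0 t = 0

/-- Profiles of fronts travelling at speed `c` connecting `um` to `up`
(nonconstant solutions of `φ'' = -cφ' + ∇V(φ)`). -/
def Phi (V : Euc n → ℝ) (c : ℝ) (um up : Euc n) : Set (ℝ → Euc n) :=
  {φ | (∃ ξ₁ ξ₂ : ℝ, φ ξ₁ ≠ φ ξ₂) ∧
    (∀ ξ : ℝ, DifferentiableAt ℝ φ ξ) ∧ (∀ ξ : ℝ, DifferentiableAt ℝ (deriv φ) ξ) ∧
    (∀ ξ : ℝ, deriv (deriv φ) ξ = -(c • deriv φ ξ) + gradient V (φ ξ)) ∧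
    Tendsto φ atBot (𝓝 um) ∧ Tendsto φ atTop (𝓝 up)}

/-- Fronts travelling at speed `c` invading the equilibrium `mp`. -/
def PhiInv (V : Euc n → ℝ) (c : ℝ) (mp : Euc n) : Set (ℝ → Euc n) :=
  ⋃ mm ∈ MinSet V, Phi V c mm mp

/-- Normalized front profiles. -/
def PhiNorm (V : Euc n → ℝ) (dEsc c : ℝ) (mm mp : Euc n) : Set (ℝ → Euc n) :=
  {φ | φ ∈ Phi V c mm mp ∧ ‖φ 0 - mp‖ = dEsc ∧ ∀ ξ > (0:ℝ), ‖φ ξ - mp‖ < dEsc}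

/-- Normalized front profiles invading `mp`. -/
def PhiNormInv (V : Euc n → ℝ) (dEsc c : ℝ) (mp : Euc n) : Set (ℝ → Euc n) :=
  ⋃ mm ∈ MinSet V, PhiNorm V dEsc c mm mp

/-- Every critical point of `V` is nondegenerate. -/
def HNonDeg (V : Euc n → ℝ) : Prop :=
  ∀ x : Euc n, gradient V x = 0 → ∀ v : Euc n, hess V x v = 0 → v = 0

/-- Every front travelling at a positive speed and invading a minimum point is bistable. -/
def HOnlyBist (V : Euc n → ℝ) : Prop :=
  ∀ mp ∈ MinSet V, ∀ um : Euc n, gradient V um = 0 →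
    ∀ c > (0:ℝ), (Phi V c um mp).Nonempty → um ∈ MinSet V

/-- The set of invading speeds has empty interior. -/
def HDiscVel (V : Euc n → ℝ) : Prop :=
  ∀ mp ∈ MinSet V, interior {c : ℝ | 0 ≤ c ∧ (PhiInv V c mp).Nonempty} = ∅

/-- The set of initial values of normalized invading fronts is totally disconnected. -/
def HDiscFront (V : Euc n → ℝ) (dEsc : ℝ) : Prop :=
  ∀ mp ∈ MinSet V, ∀ c > (0:ℝ),
    IsTotallyDisconnected
      {p : Euc n × Euc n | ∃ φ ∈ PhiNormInv V dEsc c mp, p = (φ 0, deriv φ 0)}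

/-- The generic hypotheses on the potential. -/
def HGen (V : Euc n → ℝ) (dEsc : ℝ) : Prop :=
  HNonDeg V ∧ HOnlyBist V ∧ HDiscVel V ∧ HDiscFront V dEsc

/-- The solution is stable at infinity, close to the minimum point `m`. -/
def StableAtInfinity (V : Euc n → ℝ) (u : ℝ → ℝ → Euc n) (m : Euc n) : Prop :=
  m ∈ MinSet V ∧
    Tendsto (fun t => limsup (fun r => ‖u r t - m‖) atTop) atTop (𝓝 0)

/-- Propagating terrace of bistable fronts connecting `mLoc` to `mFar`. -/
def IsTerrace (V : Euc n → ℝ) (mLoc mFar : Euc n) (T : ℝ → ℝ → Euc n) : Prop :=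
  ∃ (q : ℕ) (ms : ℕ → Euc n) (cs : ℕ → ℝ) (φs : ℕ → ℝ → Euc n) (rs : ℕ → ℝ → ℝ),
    ms 0 = mFar ∧ ms q = mLoc ∧ (∀ i, i ≤ q → ms i ∈ MinSet V) ∧
    (∀ i, i < q → V (ms (i + 1)) < V (ms i)) ∧
    (∀ i, 1 ≤ i → i ≤ q → 0 < cs i) ∧
    (∀ i, 1 ≤ i → i + 1 ≤ q → cs (i + 1) ≤ cs i) ∧
    (∀ i, 1 ≤ i → i ≤ q → φs i ∈ Phi V (cs i) (ms i) (ms (i - 1))) ∧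
    (∀ i, 1 ≤ i → i ≤ q →
      (∀ t : ℝ, 0 ≤ t → 0 ≤ rs i t) ∧ (∀ t : ℝ, DifferentiableAt ℝ (rs i) t) ∧
        Tendsto (deriv (rs i)) atTop (𝓝 (cs i))) ∧
    (∀ i, 1 ≤ i → i + 1 ≤ q → Tendsto (fun t => rs (i + 1) t - rs i t) atTop atTop) ∧
    (∀ r t : ℝ, 0 ≤ r → 0 ≤ t →
      T r t = ms 0 + ∑ i ∈ Finset.Icc 1 q, (φs i (r - rs i t) - ms (i - 1)))

/-- Hypothesis `(H_hom)` unbundled: `u` is close to `m` on a growing interval around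
`rHom t`, travelling at asymptotic speed `cHom`; closeness is measured in `H¹` norm. -/
def HHomWith (u : ℝ → ℝ → Euc n) (m : Euc n) (cHom : ℝ) (rHom : ℝ → ℝ) : Prop :=
  0 < cHom ∧ (∀ t : ℝ, DifferentiableAt ℝ rHom t) ∧
    Tendsto (deriv rHom) atTop (𝓝 cHom) ∧
    ∀ L > (0:ℝ),
      Tendsto
        (fun t => ∫ r in (-L)..L,
          (‖u (rHom t + r) t - m‖ ^ 2 + ‖ur u (rHom t + r) t‖ ^ 2))
        atTop (𝓝 0)

/-- The set whose supremum defines the Escape point `r_Esc(t)`. -/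
def rEscSet (u : ℝ → ℝ → Euc n) (m : Euc n) (dEsc : ℝ) (rHom : ℝ → ℝ) (t : ℝ) : Set ℝ :=
  {r | r ∈ Icc 0 (rHom t) ∧ ‖u r t - m‖ = dEsc}

/-- The Escape point `r_Esc(t)`. -/
def rEscF (u : ℝ → ℝ → Euc n) (m : Euc n) (dEsc : ℝ) (rHom : ℝ → ℝ) (t : ℝ) : ℝ :=
  sSup (rEscSet u m dEsc rHom t)

/-- The upper limit mean speed `c_Esc` of the Escape point. -/
def cEscV (u : ℝ → ℝ → Euc n) (m : Euc n) (dEsc : ℝ) (rHom : ℝ → ℝ) : ℝ :=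
  limsup (fun t => rEscF u m dEsc rHom t / t) atTop

/-- `q_hull`: minimal convexity of the lower quadratic hulls of `V` at minimum points. -/
def qHull (V : Euc n → ℝ) : ℝ :=
  sInf {q : ℝ | ∃ m ∈ MinSet V, ∃ x : Euc n, x ≠ m ∧ q = (V x - V m) / ‖x - m‖ ^ 2}

/-- The weight `w` of the energy in the firewall functionals. -/
def wV (V : Euc n → ℝ) : ℝ := 1 / max 1 (-(4 * qHull V))

/-- The decay rate `κ₀`. -/
def kappa0 (lmin : ℝ) : ℝ := min (1 / 2) (lmin / 8)

/-- The "small curvature" radius `r_sc`. -/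
def rsc (d : ℕ) (lmin : ℝ) : ℝ := max (2 * ((d : ℝ) - 1)) (8 * ((d : ℝ) - 1) / lmin)

/-- The weight function `T_ρ ψ₀`. -/
def Tpsi (d : ℕ) (lmin : ℝ) (ρ r : ℝ) : ℝ :=
  if r ≤ rsc d lmin then Real.exp (-(kappa0 lmin) * |r - ρ|) * (r / rsc d lmin) ^ (d - 1)
  else Real.exp (-(kappa0 lmin) * |r - ρ|)

/-- The firewall functional `F₀` in the laboratory frame. -/
def F0 (V : Euc n → ℝ) (d : ℕ) (lmin : ℝ) (u : ℝ → ℝ → Euc n) (ρ t : ℝ) : ℝ :=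
  ∫ r in Ioi (0:ℝ),
    Tpsi d lmin ρ r * (wV V * (‖ur u r t‖ ^ 2 / 2 + V (u r t)) + ‖u r t‖ ^ 2 / 2)

/-- The set `Σ₀(t)` where the solution Escapes at distance `dEsc` from the origin. -/
def Sigma0 (u : ℝ → ℝ → Euc n) (dEsc t : ℝ) : Set ℝ := {r | 0 ≤ r ∧ dEsc < ‖u r t‖}

/-- The firewall differential inequality in the laboratory frame. -/
def FireIneq (V : Euc n → ℝ) (d : ℕ) (lmin dEsc : ℝ) (u : ℝ → ℝ → Euc n) (ν K : ℝ) : Prop :=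
  ∀ ρ ≥ rsc d lmin, ∀ t > (0:ℝ),
    DifferentiableAt ℝ (fun s => F0 V d lmin u ρ s) t ∧
    deriv (fun s => F0 V d lmin u ρ s) t ≤
      -ν * F0 V d lmin u ρ t + K * ∫ r in Sigma0 u dEsc t, Tpsi d lmin ρ r

/-- The quantity `δ = d_Esc √(min(w/2,1/4)/(κ₀+1))`. -/
def deltaEsc (dEsc w κ₀ : ℝ) : ℝ := dEsc * Real.sqrt (min (w / 2) (1 / 4) / (κ₀ + 1))

/-- The length `L₀`. -/
def L0c (κ₀ ν K δ : ℝ) : ℝ := κ₀⁻¹ * Real.log (16 * K / (ν * δ ^ 2 * κ₀))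

/-- The no-escape speed `c_noesc`. -/
def cNoEsc (κ₀ K L₀ δ : ℝ) : ℝ := 8 * K * L₀ / (κ₀ * δ ^ 2)

/-- The no-escape hull `h`. -/
def hull (δ L₀ : ℝ) (x : ℝ) : EReal :=
  if x < 0 then ⊤
  else if x ≤ L₀ then ((δ ^ 2 / 2 * (1 - x / (2 * L₀)) : ℝ) : EReal)
  else ((δ ^ 2 / 4 : ℝ) : EReal)

/-- The standing hypothesis that the firewall is below the two mirror hulls positioned
around `rHom t`. -/
def HullBound (V : Euc n → ℝ) (d : ℕ) (lmin : ℝ) (u : ℝ → ℝ → Euc n) (δ L₀ : ℝ)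
    (rHom : ℝ → ℝ) : Prop :=
  ∀ t ≥ (0:ℝ), rsc d lmin ≤ rHom t - 1 ∧
    ∀ r ≥ rsc d lmin, ((F0 V d lmin u r t : ℝ) : EReal) ≤
      max (hull δ L₀ (r - (rHom t - 1))) (hull δ L₀ (rHom t - r))

/-- The set whose infimum defines the escape point `r_esc(t)`. -/
def rescSet (V : Euc n → ℝ) (d : ℕ) (lmin : ℝ) (u : ℝ → ℝ → Euc n) (δ L₀ : ℝ)
    (rHom : ℝ → ℝ) (t : ℝ) : Set ℝ :=
  {rl | rl ∈ Icc (rsc d lmin) (rHom t) ∧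
    ∀ r ≥ rsc d lmin, ((F0 V d lmin u r t : ℝ) : EReal) ≤
      max (hull δ L₀ (r - rl)) (hull δ L₀ (rHom t - r))}

/-- The escape point `r_esc(t)`. -/
def rescF (V : Euc n → ℝ) (d : ℕ) (lmin : ℝ) (u : ℝ → ℝ → Euc n) (δ L₀ : ℝ)
    (rHom : ℝ → ℝ) (t : ℝ) : ℝ :=
  sInf (rescSet V d lmin u δ L₀ rHom t)

/-- `c̄`: upper limit of mean variations of a function over time intervals of length `s`. -/
def cbarF (f : ℝ → ℝ) : ℝ :=
  limsup (fun s => sSup {x : ℝ | ∃ t ≥ (0:ℝ), x = f (t + s) - f t} / s) atTop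

/-- `c̲`: lower limit of mean variations of a function over time intervals of length `s`. -/
def cunderF (f : ℝ → ℝ) : ℝ :=
  liminf (fun s => sInf {x : ℝ | ∃ t ≥ (0:ℝ), x = f (t + s) - f t} / s) atTop

/-- The decay rate `κ` in the travelling frame. -/
def kappaTF (lmin cno : ℝ) : ℝ := min (1 / 4) (lmin / (16 * (cno + 1)))

/-- The cut-off speed `c_cut` in the travelling frame. -/
def ccutTF (lmin lmax cno : ℝ) : ℝ := min (lmin / (8 * lmax)) (lmin / (8 * (cno + 1)))

/-- The energy weight `w'` in the travelling frame. -/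
def wTF (V : Euc n → ℝ) (cno : ℝ) : ℝ := min (wV V) (1 / (cno + 1) ^ 2)

/-- The weight function `χ` of the localized energy in the travelling frame. -/
def chiTF (d : ℕ) (lmin lmax cno c xcut r0 : ℝ) (ρ s : ℝ) : ℝ :=
  if ρ ≤ -r0 - c * s + rsc d lmin then
    Real.exp (c * ρ) * ((r0 + c * s + ρ) / rsc d lmin) ^ (d - 1)
  else if ρ ≤ xcut + ccutTF lmin lmax cno * s then Real.exp (c * ρ)
  else
    Real.exp ((c + kappaTF lmin cno) * (xcut + ccutTF lmin lmax cno * s) -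
      kappaTF lmin cno * ρ)

/-- The weight function `ψ` of the firewall in the travelling frame. -/
def psiTF (d : ℕ) (lmin lmax cno c xcut r0 : ℝ) (ρ s : ℝ) : ℝ :=
  if ρ ≤ -r0 - c * s + rsc d lmin then
    Real.exp ((c + kappaTF lmin cno) * ρ -
        kappaTF lmin cno * (xcut + ccutTF lmin lmax cno * s)) *
      ((r0 + c * s + ρ) / rsc d lmin) ^ (d - 1)
  else if ρ ≤ xcut + ccutTF lmin lmax cno * s then
    Real.exp ((c + kappaTF lmin cno) * ρ -
      kappaTF lmin cno * (xcut + ccutTF lmin lmax cno * s))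
  else
    Real.exp ((c + kappaTF lmin cno) * (xcut + ccutTF lmin lmax cno * s) -
      kappaTF lmin cno * ρ)

/-- The firewall functional `F(s)` in the travelling frame. -/
def FTF (V : Euc n → ℝ) (d : ℕ) (lmin lmax cno : ℝ) (u : ℝ → ℝ → Euc n)
    (t0 c xcut r0 : ℝ) (s : ℝ) : ℝ :=
  ∫ ρ in Ioi (-r0 - c * s),
    psiTF d lmin lmax cno c xcut r0 ρ s *
      (wTF V cno *
          (‖ur u (r0 + c * s + ρ) (t0 + s)‖ ^ 2 / 2 + V (u (r0 + c * s + ρ) (t0 + s))) +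
        ‖u (r0 + c * s + ρ) (t0 + s)‖ ^ 2 / 2)

/-- The set `Σ(s)` where the solution Escapes, in the travelling frame. -/
def SigmaTF (u : ℝ → ℝ → Euc n) (d : ℕ) (lmin dEsc : ℝ) (t0 c r0 : ℝ) (s : ℝ) : Set ℝ :=
  {ρ | -r0 - c * s + rsc d lmin ≤ ρ ∧ dEsc < ‖u (r0 + c * s + ρ) (t0 + s)‖}

/-- The weight function `ψ̃` in the standing frame. -/
def psiSF (d : ℕ) (κ cm cp : ℝ) (r t : ℝ) : ℝ :=
  if r ≤ cm * t then r ^ (d - 1) * Real.exp (-κ * (cm * t - r))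
  else if r ≤ cp * t then r ^ (d - 1)
  else r ^ (d - 1) * Real.exp (-κ * (r - cp * t))

/-- The firewall functional `F̃` in the standing frame. -/
def FSF (V : Euc n → ℝ) (d : ℕ) (κ cm cp : ℝ) (u : ℝ → ℝ → Euc n) (t : ℝ) : ℝ :=
  ∫ r in Ioi (0:ℝ),
    psiSF d κ cm cp r t * (wV V * (‖ur u r t‖ ^ 2 / 2 + V (u r t)) + ‖u r t‖ ^ 2 / 2)

/-- The quantity `δ_dissip(t)` measuring the dissipation around the escape point. -/
def deltaDissip (u : ℝ → ℝ → Euc n) (re : ℝ → ℝ) (cesc : ℝ) (t : ℝ) : ℝ :=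
  sInf {ε : ℝ | 0 < ε ∧
    (∫ τ in (-1:ℝ)..1, ∫ ρ in (-(1/ε))..(1/ε),
      ‖ut u (re (t + τ) + ρ) (t + τ) + cesc • ur u (re (t + τ) + ρ) (t + τ)‖ ^ 2) ≤ ε}

/-- `u` solves the radially symmetric system with initial datum `u₀`, in the sense of the
semi-flow on bounded continuous functions (classical for positive times). -/
def SolvesWithInit (d : ℕ) (V : Euc n → ℝ) (u : ℝ → ℝ → Euc n) (u₀ : ℝ → Euc n) : Prop :=
  (∀ r : ℝ, 0 ≤ r → u r 0 = u₀ r) ∧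
  (∀ t : ℝ, 0 ≤ t → ContinuousOn (fun r => u r t) (Ici 0) ∧ ∃ C, ∀ r : ℝ, 0 ≤ r → ‖u r t‖ ≤ C) ∧
  (∀ t : ℝ, 0 ≤ t → ∀ ε > (0:ℝ), ∃ δ > (0:ℝ), ∀ t' : ℝ, 0 ≤ t' → |t' - t| ≤ δ →
    ∀ r : ℝ, 0 ≤ r → ‖u r t' - u r t‖ ≤ ε) ∧
  (∀ t > (0:ℝ), ∀ r > (0:ℝ),
    DifferentiableAt ℝ (fun s => u s t) r ∧ DifferentiableAt ℝ (fun s => ur u s t) r) ∧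
  (∀ t > (0:ℝ), ∀ r : ℝ, 0 ≤ r → DifferentiableAt ℝ (fun s => u r s) t) ∧
  (∀ t > (0:ℝ), ∀ r > (0:ℝ),
    ut u r t = -gradient V (u r t) + (((d : ℝ) - 1) / r) • ur u r t + urr u r t) ∧
  (∀ t > (0:ℝ), DifferentiableAt ℝ (fun s => u s t) 0 ∧ ur u 0 t = 0)

/-- Second-order comparison on the unit interval from a lower bound on the second derivative. -/
theorem taylor_lower_of_second_deriv_ge {g g' g'' : ℝ → ℝ} {a : ℝ}
    (hg : ∀ θ, HasDerivAt g (g' θ) θ) (hg' : ∀ θ, HasDerivAt g' (g'' θ) θ) (h0 : g' 0 = 0)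
    (ha : ∀ θ ∈ Icc (0:ℝ) 1, a ≤ g'' θ) : a ≤ g' 1 ∧ a / 2 ≤ g 1 - g 0 := by
  have hmono : MonotoneOn (fun θ => g' θ - a * θ) (Icc (0:ℝ) 1) := by
    have hd : ∀ θ, HasDerivAt (fun θ => g' θ - a * θ) (g'' θ - a) θ := fun θ => by
      simpa using (hg' θ).fun_sub ((hasDerivAt_id θ).const_mul a)
    refine monotoneOn_of_deriv_nonneg (convex_Icc _ _)
      (fun θ _ => (hd θ).continuousAt.continuousWithinAt)
      (fun θ _ => (hd θ).differentiableAt.differentiableWithinAt) fun θ hθ => ?_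
    rw [(hd θ).deriv]
    linarith [ha θ (interior_subset hθ)]
  have hlow : ∀ θ ∈ Icc (0:ℝ) 1, a * θ ≤ g' θ := fun θ hθ => by
    have := hmono (left_mem_Icc.2 zero_le_one) hθ hθ.1
    simp only [h0] at this
    linarith
  refine ⟨by simpa using hlow 1 (right_mem_Icc.2 zero_le_one), ?_⟩
  have hmono₂ : MonotoneOn (fun θ => g θ - a / 2 * θ ^ 2) (Icc (0:ℝ) 1) := by
    have hd : ∀ θ, HasDerivAt (fun θ => g θ - a / 2 * θ ^ 2) (g' θ - a * θ) θ := fun θ =>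
      ((hg θ).fun_sub ((hasDerivAt_pow 2 θ).const_mul (a / 2))).congr_deriv
        (by push_cast; ring)
    refine monotoneOn_of_deriv_nonneg (convex_Icc _ _)
      (fun θ _ => (hd θ).continuousAt.continuousWithinAt)
      (fun θ _ => (hd θ).differentiableAt.differentiableWithinAt) fun θ hθ => ?_
    rw [(hd θ).deriv]
    linarith [hlow θ (interior_subset hθ)]
  have := hmono₂ (left_mem_Icc.2 zero_le_one) (right_mem_Icc.2 zero_le_one) zero_le_one
  simp only at this
  linarith

theorem hasDerivAt_comp_gradient {V : Euc n → ℝ} (hV : Differentiable ℝ V) {γ : ℝ → Euc n}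
    {γ' : Euc n} {s : ℝ} (hγ : HasDerivAt γ γ' s) :
    HasDerivAt (fun x => V (γ x)) ⟪gradient V (γ s), γ'⟫ s := by
  have h := (hV (γ s)).hasGradientAt.hasFDerivAt.comp_hasDerivAt s hγ
  simpa [Function.comp_def] using h

theorem contDiff_gradient {V : Euc n → ℝ} (hV : ContDiff ℝ 2 V) : ContDiff ℝ 1 (gradient V) := by
  have h : ContDiff ℝ 1 (fderiv ℝ V) := hV.fderiv_right (by norm_num)
  exact (InnerProductSpace.toDual ℝ (Euc n)).symm.contDiff.comp h

namespace EscData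

variable {V : Euc n → ℝ}

theorem near_min (D : EscData n V) (hV : ContDiff ℝ 2 V) {m x : Euc n} (hm : m ∈ MinSet V)
    (hx : ‖x - m‖ ≤ D.dEsc) :
    D.lmin / 2 * ‖x - m‖ ^ 2 ≤ ⟪gradient V x, x - m⟫ ∧
      D.lmin / 4 * ‖x - m‖ ^ 2 ≤ V x - V m ∧ V x - V m ≤ D.lmax * ‖x - m‖ ^ 2 := by
  set v := x - m with hv
  have hγ : ∀ θ : ℝ, HasDerivAt (fun θ : ℝ => m + θ • v) v θ := fun θ => by
    simpa using ((hasDerivAt_id θ).smul_const v).const_add m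
  have hg : ∀ θ : ℝ, HasDerivAt (fun θ : ℝ => V (m + θ • v)) ⟪gradient V (m + θ • v), v⟫ θ :=
    fun θ => hasDerivAt_comp_gradient (hV.differentiable (by norm_num)) (hγ θ)
  have hg' : ∀ θ : ℝ, HasDerivAt (fun θ : ℝ => ⟪gradient V (m + θ • v), v⟫)
      ⟪v, hess V (m + θ • v) v⟫ θ := fun θ => by
    have h1 := (((contDiff_gradient hV).differentiable (by norm_num))
      (m + θ • v)).hasFDerivAt.comp_hasDerivAt θ (hγ θ)
    have h2 := h1.inner ℝ (hasDerivAt_const θ v)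
    simp only [inner_zero_right, zero_add] at h2
    rw [real_inner_comm]
    exact h2
  have h0 : ⟪gradient V (m + (0:ℝ) • v), v⟫ = 0 := by simp [hm.1]
  have hin : ∀ θ ∈ Icc (0:ℝ) 1, ‖m + θ • v - m‖ ≤ D.dEsc := fun θ hθ => by
    rw [add_sub_cancel_left, norm_smul, Real.norm_of_nonneg hθ.1]
    nlinarith [hθ.2, norm_nonneg v]
  obtain ⟨h1, h2⟩ := taylor_lower_of_second_deriv_ge hg hg' h0
    (fun θ hθ => D.esc_lower m hm _ (hin θ hθ) v)
  obtain ⟨-, h3⟩ := taylor_lower_of_second_deriv_ge (a := -(2 * D.lmax * ‖v‖ ^ 2))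
    (fun θ => (hg θ).neg) (fun θ => (hg' θ).neg) (by simpa using h0)
    (fun θ hθ => neg_le_neg (D.esc_upper m hm _ (hin θ hθ) v))
  have hx1 : m + (1:ℝ) • v = x := by simp [hv]
  simp only [hx1, zero_smul, add_zero, Pi.neg_apply] at h1 h2 h3
  exact ⟨h1, by linarith, by linarith⟩

theorem lmin_le_lmax (D : EscData n V) (hn : 1 ≤ n) (h0 : (0 : Euc n) ∈ MinSet V) :
    D.lmin ≤ D.lmax := by
  have h := (D.lower 0 h0 (EuclideanSpace.single ⟨0, hn⟩ 1)).trans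
    (D.upper 0 h0 (EuclideanSpace.single ⟨0, hn⟩ 1))
  simpa using h

end EscData

/-- A coercive potential is bounded from below. -/
theorem HCoerc.exists_lower_bound {V : Euc n → ℝ} (hV : ContDiff ℝ 2 V) (hc : HCoerc V) :
    ∃ B, ∀ x, B ≤ V x := by
  obtain ⟨ε, hε, R, hR⟩ := hc
  set ρ := max R 1 with hρ
  have hρ1 : 1 ≤ ρ := le_max_right _ _
  obtain ⟨B, hB⟩ := ((isCompact_closedBall (0 : Euc n) ρ).image hV.continuous).bddBelow
  have hball : ∀ x : Euc n, ‖x‖ ≤ ρ → B ≤ V x := fun x hx =>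
    hB (mem_image_of_mem V (by simpa using hx))
  refine ⟨B, fun x => ?_⟩
  rcases le_total ‖x‖ ρ with hx | hx
  · exact hball x hx
  have hx0 : 0 < ‖x‖ := by linarith
  have hd : ∀ θ : ℝ, HasDerivAt (fun θ : ℝ => V (θ • x)) ⟪gradient V (θ • x), x⟫ θ := fun θ =>
    hasDerivAt_comp_gradient (hV.differentiable (by norm_num))
      (by simpa using (hasDerivAt_id θ).smul_const x)
  have hmono : MonotoneOn (fun θ : ℝ => V (θ • x)) (Ici (ρ / ‖x‖)) := by
    refine monotoneOn_of_deriv_nonneg (convex_Ici _)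
      (fun θ _ => (hd θ).continuousAt.continuousWithinAt)
      (fun θ _ => (hd θ).differentiableAt.differentiableWithinAt) fun θ hθ => ?_
    rw [(hd θ).deriv]
    have hθ' : ρ / ‖x‖ ≤ θ := interior_subset hθ
    have hθ0 : 0 < θ := lt_of_lt_of_le (by positivity) hθ'
    have hnorm : R ≤ ‖θ • x‖ := by
      rw [norm_smul, Real.norm_of_nonneg hθ0.le]
      exact (le_max_left _ _).trans ((div_le_iff₀ hx0).1 hθ')
    have h := hR _ hnorm
    rw [real_inner_smul_left, real_inner_comm] at h
    exact nonneg_of_mul_nonneg_right (le_trans (by positivity) h) hθ0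
  have h1 : ρ / ‖x‖ ≤ 1 := (div_le_one hx0).2 hx
  have h := hmono (mem_Ici.2 le_rfl) (mem_Ici.2 h1) h1
  simp only [one_smul] at h
  refine (hball _ ?_).trans h
  rw [norm_smul, Real.norm_of_nonneg (by positivity)]
  exact (div_mul_cancel₀ _ hx0.ne').le

theorem bddBelow_qHull_set {V : Euc n → ℝ} (hV : ContDiff ℝ 2 V) (hc : HCoerc V)
    (D : EscData n V) :
    BddBelow {q : ℝ | ∃ m ∈ MinSet V, ∃ x : Euc n, x ≠ m ∧ q = (V x - V m) / ‖x - m‖ ^ 2} := by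
  obtain ⟨B, hB⟩ := hc.exists_lower_bound hV
  obtain ⟨ε, hε, R, hR⟩ := hc
  obtain ⟨A, hA⟩ := ((isCompact_closedBall (0 : Euc n) |R|).image hV.continuous).bddAbove
  have hmA : ∀ m ∈ MinSet V, V m ≤ A := fun m hm => by
    refine hA (mem_image_of_mem V ?_)
    rw [mem_closedBall_zero_iff]
    by_contra! hlt
    have h := hR m ((le_abs_self R).trans hlt.le)
    rw [hm.1, inner_zero_right] at h
    have : 0 < ‖m‖ := (abs_nonneg R).trans_lt hlt
    nlinarith [mul_pos hε (pow_pos this 2)]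
  refine ⟨-(|B - A| / D.dEsc ^ 2), ?_⟩
  rintro q ⟨m, hm, x, hxm, rfl⟩
  have hpos : 0 < ‖x - m‖ := norm_pos_iff.2 (sub_ne_zero.2 hxm)
  have hdE := D.dEsc_pos
  rcases le_total ‖x - m‖ D.dEsc with h | h
  · have h1 := (D.near_min hV hm h).2.1
    have hl := D.lmin_pos
    have h2 : 0 ≤ V x - V m := le_trans (by positivity) h1
    have h3 : 0 ≤ (V x - V m) / ‖x - m‖ ^ 2 := by positivity
    have h4 : 0 ≤ |B - A| / D.dEsc ^ 2 := by positivity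
    linarith
  · rw [← neg_div]
    calc -|B - A| / D.dEsc ^ 2 ≤ -|B - A| / ‖x - m‖ ^ 2 := by
          rw [neg_div, neg_div, neg_le_neg_iff]
          gcongr
      _ ≤ _ := by
          gcongr
          linarith [neg_abs_le (B - A), hB x, hmA m hm]

theorem wV_pos (V : Euc n → ℝ) : 0 < wV V := by
  unfold wV
  positivity

/-- The quadratic part of the firewall compensates the negative part of the potential. -/
theorem neg_sq_div_four_le_wV_mul {V : Euc n → ℝ} (hV : ContDiff ℝ 2 V) (hc : HCoerc V)
    (D : EscData n V) (h0 : (0 : Euc n) ∈ MinSet V) (hV0 : V 0 = 0) (x : Euc n) :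
    -(‖x‖ ^ 2 / 4) ≤ wV V * V x := by
  rcases eq_or_ne x 0 with rfl | hx
  · simp [hV0]
  have hq : qHull V ≤ V x / ‖x‖ ^ 2 :=
    csInf_le (bddBelow_qHull_set hV hc D) ⟨0, h0, x, hx, by simp [hV0]⟩
  have hpos : 0 < ‖x‖ ^ 2 := by positivity
  rw [le_div_iff₀ hpos] at hq
  have hmax : 0 < max 1 (-(4 * qHull V)) := by positivity
  rw [wV, one_div, ← div_eq_inv_mul, le_div_iff₀ hmax]
  have h1 : -(4 * qHull V) ≤ max 1 (-(4 * qHull V)) := le_max_right _ _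
  nlinarith

/-! ### Half-line integrals -/

/-- An integrable derivative on the half-line integrates to zero when the primitive vanishes at
both ends; the derivative may fail to exist on a countable set. -/
theorem integral_Ioi_eq_zero_of_hasDerivAt_off_countable {f f' : ℝ → ℝ} {S : Set ℝ}
    (hS : S.Countable) (hc : Continuous f) (hd : ∀ x ∈ Ioi (0:ℝ) \ S, HasDerivAt f (f' x) x)
    (hi : IntegrableOn f' (Ioi 0)) (h0 : f 0 = 0) (hlim : Tendsto f atTop (𝓝 0)) :
    ∫ x in Ioi (0:ℝ), f' x = 0 := by
  refine tendsto_nhds_unique (intervalIntegral_tendsto_integral_Ioi 0 hi tendsto_id) ?_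
  refine hlim.congr' ?_
  filter_upwards [eventually_ge_atTop (0:ℝ)] with b hb
  have h := integral_eq_of_hasDerivAt_off_countable_of_le f f' hb hS hc.continuousOn
    (fun x hx => hd x ⟨hx.1.1, hx.2⟩)
    ((intervalIntegrable_iff_integrableOn_Ioc_of_le hb).2 (hi.mono_set Ioc_subset_Ioi_self))
  simp [h, h0]

theorem integrableOn_pow_mul_exp_neg {κ : ℝ} (hκ : 0 < κ) (m : ℕ) :
    IntegrableOn (fun r : ℝ => r ^ m * Real.exp (-κ * r)) (Ioi 0) := by
  have h := integrableOn_rpow_mul_exp_neg_mul_rpow (s := m) (p := 1) (b := κ)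
    (by linarith [(Nat.cast_nonneg m : (0:ℝ) ≤ m)]) zero_lt_one hκ
  simpa using h

theorem tendsto_pow_mul_exp_neg {κ : ℝ} (hκ : 0 < κ) (m : ℕ) :
    Tendsto (fun r : ℝ => r ^ m * Real.exp (-κ * r)) atTop (𝓝 0) := by
  have h := tendsto_rpow_mul_exp_neg_mul_atTop_nhds_zero (m : ℝ) κ hκ
  simpa using h

/-- Dominated convergence along a filter, including integrability of the limit. -/
theorem tendsto_integral_and_integrable_of_dominated {μ : Measure ℝ} {l : Filter ℝ} [l.NeBot]
    [l.IsCountablyGenerated] {H : ℝ → ℝ → ℝ} {L B : ℝ → ℝ}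
    (hm : ∀ᶠ s in l, AEStronglyMeasurable (H s) μ) (hb : ∀ᶠ s in l, ∀ᵐ r ∂μ, ‖H s r‖ ≤ B r)
    (hB : Integrable B μ) (hl : ∀ᵐ r ∂μ, Tendsto (fun s => H s r) l (𝓝 (L r))) :
    Integrable L μ ∧ Tendsto (fun s => ∫ r, H s r ∂μ) l (𝓝 (∫ r, L r ∂μ)) := by
  refine ⟨?_, tendsto_integral_filter_of_dominated_convergence B hm hb hB hl⟩
  obtain ⟨x, hx⟩ := l.exists_seq_tendsto
  obtain ⟨N, hN⟩ := eventually_atTop.1 (hx.eventually (hm.and hb))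
  have hx' : Tendsto (fun k => x (k + N)) atTop l := hx.comp (tendsto_add_atTop_nat N)
  refine hB.mono' (aestronglyMeasurable_of_tendsto_ae atTop
    (fun k => (hN (k + N) (Nat.le_add_left _ _)).1) ?_) ?_
  · filter_upwards [hl] with r hr using hr.comp hx'
  · have hall : ∀ᵐ r ∂μ, ∀ k, ‖H (x (k + N)) r‖ ≤ B r :=
      ae_all_iff.2 fun k => (hN (k + N) (Nat.le_add_left _ _)).2
    filter_upwards [hl, hall] with r hr hbd
    exact le_of_tendsto' (hr.comp hx').norm hbd

/-! ### The cut-off factor of the standing-frame weight -/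

/-- The standing-frame weight without its Jacobian factor `r ^ (d - 1)`. -/
def cutoff (κ cm cp r s : ℝ) : ℝ := Real.exp (-κ * max 0 (max (cm * s - r) (r - cp * s)))

/-- Logarithmic space derivative of `cutoff`. -/
def cutoffR (κ cm cp r s : ℝ) : ℝ := if r < cm * s then κ else if r < cp * s then 0 else -κ

/-- Logarithmic time derivative of `cutoff`. -/
def cutoffT (κ cm cp r s : ℝ) : ℝ :=
  if r < cm * s then -(κ * cm) else if r < cp * s then 0 else κ * cp

section Cutoff

variable {κ cm cp : ℝ}

theorem psiSF_eq_cutoff (d : ℕ) (h : cm ≤ cp) {s : ℝ} (hs : 0 ≤ s) (r : ℝ) :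
    psiSF d κ cm cp r s = r ^ (d - 1) * cutoff κ cm cp r s := by
  have h1 : cm * s ≤ cp * s := mul_le_mul_of_nonneg_right h hs
  unfold psiSF cutoff
  split_ifs with h2 h3
  · rw [max_eq_right (a := 0), max_eq_left]
    · linarith
    · exact le_max_of_le_left (by linarith)
  · rw [max_eq_left (max_le (by linarith) (by linarith))]
    simp
  · rw [max_eq_right (a := 0), max_eq_right]
    · linarith
    · exact le_max_of_le_right (by linarith)

theorem continuous_cutoff (s : ℝ) : Continuous fun r => cutoff κ cm cp r s := by
  unfold cutoff
  fun_prop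

theorem cutoff_pos (r s : ℝ) : 0 < cutoff κ cm cp r s := Real.exp_pos _

theorem cutoff_le (hκ : 0 < κ) (hcp : 0 ≤ cp) {s T : ℝ} (hs : s ≤ T) (r : ℝ) :
    cutoff κ cm cp r s ≤ Real.exp (κ * cp * T) * Real.exp (-κ * r) := by
  rw [cutoff, ← Real.exp_add, Real.exp_le_exp]
  have h1 : r - cp * s ≤ max 0 (max (cm * s - r) (r - cp * s)) :=
    (le_max_right _ _).trans (le_max_right _ _)
  have h2 : cp * s ≤ cp * T := mul_le_mul_of_nonneg_left hs hcp
  nlinarith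

theorem abs_cutoff_sub_le (hκ : 0 < κ) (hcm : 0 ≤ cm) (h : cm ≤ cp) {s s' T : ℝ} (hs : s ≤ T)
    (hs' : s' ≤ T) (r : ℝ) :
    |cutoff κ cm cp r s - cutoff κ cm cp r s'| ≤
      κ * cp * |s - s'| * (Real.exp (κ * cp * T) * Real.exp (-κ * r)) := by
  have hcp : 0 ≤ cp := hcm.trans h
  wlog hle : cutoff κ cm cp r s' ≤ cutoff κ cm cp r s generalizing s s'
  · rw [abs_sub_comm, abs_sub_comm s]
    exact this hs' hs (le_of_not_ge hle)
  rw [abs_of_nonneg (sub_nonneg.2 hle)]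
  have hb := cutoff_le (cm := cm) hκ hcp hs r
  set a := max 0 (max (cm * s - r) (r - cp * s)) with ha
  set b := max 0 (max (cm * s' - r) (r - cp * s')) with hb'
  have hab : b - a ≤ cp * |s - s'| := by
    have e1 : cm * (s' - s) ≤ cp * |s - s'| :=
      calc cm * (s' - s) ≤ cm * |s' - s| := mul_le_mul_of_nonneg_left (le_abs_self _) hcm
        _ ≤ cp * |s - s'| := by rw [abs_sub_comm]; gcongr
    have e2 : cp * (s - s') ≤ cp * |s - s'| := mul_le_mul_of_nonneg_left (le_abs_self _) hcp
    have e3 : cm * s - r ≤ a := (le_max_left _ _).trans (le_max_right _ _)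
    have e4 : r - cp * s ≤ a := (le_max_right _ _).trans (le_max_right _ _)
    have e5 : 0 ≤ a := le_max_left _ _
    have e6 : 0 ≤ cp * |s - s'| := by positivity
    rw [sub_le_iff_le_add']
    refine max_le (by linarith) (max_le ?_ ?_) <;> linarith
  have hexp : cutoff κ cm cp r s' = cutoff κ cm cp r s * Real.exp (-κ * (b - a)) := by
    rw [cutoff, cutoff, ← Real.exp_add]
    congr 1
    ring
  have h1 := Real.add_one_le_exp (-κ * (b - a))
  have hpos := cutoff_pos (κ := κ) (cm := cm) (cp := cp) r s
  calc cutoff κ cm cp r s - cutoff κ cm cp r s'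
      = cutoff κ cm cp r s * (1 - Real.exp (-κ * (b - a))) := by rw [hexp]; ring
    _ ≤ cutoff κ cm cp r s * (κ * cp * |s - s'|) := by
        refine mul_le_mul_of_nonneg_left ?_ hpos.le
        nlinarith
    _ ≤ _ := by
        rw [mul_comm]
        exact mul_le_mul_of_nonneg_left hb (by positivity)

theorem abs_cutoffR_le (hκ : 0 < κ) (r s : ℝ) : |cutoffR κ cm cp r s| ≤ κ := by
  unfold cutoffR
  split_ifs <;> simp [abs_of_pos hκ, hκ.le]

theorem cutoffT_le (hκ : 0 < κ) (hcm : 0 ≤ cm) (h : cm ≤ cp) (r s : ℝ) :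
    cutoffT κ cm cp r s ≤ κ * cp := by
  have : 0 ≤ κ * cp := mul_nonneg hκ.le (hcm.trans h)
  unfold cutoffT
  split_ifs
  · nlinarith
  · exact this
  · exact le_rfl

theorem measurable_cutoffR (s : ℝ) : Measurable fun r => cutoffR κ cm cp r s :=
  Measurable.ite measurableSet_Iio measurable_const
    (Measurable.ite measurableSet_Iio measurable_const measurable_const)

theorem hasDerivAt_cutoff (h : cm ≤ cp) {r s : ℝ} (hs : 0 < s) (h1 : r ≠ cm * s)
    (h2 : r ≠ cp * s) :
    HasDerivAt (fun x => cutoff κ cm cp x s) (cutoffR κ cm cp r s * cutoff κ cm cp r s) r ∧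
      HasDerivAt (fun x => cutoff κ cm cp r x) (cutoffT κ cm cp r s * cutoff κ cm cp r s) s := by
  have hle : cm * s ≤ cp * s := mul_le_mul_of_nonneg_right h hs.le
  have key : ∀ (f : ℝ × ℝ → ℝ) (a b : ℝ),
      (∀ᶠ p : ℝ × ℝ in 𝓝 (r, s), max 0 (max (cm * p.2 - p.1) (p.1 - cp * p.2)) = f p) →
      HasDerivAt (fun x => f (x, s)) a r → HasDerivAt (fun x => f (r, x)) b s →
      HasDerivAt (fun x => cutoff κ cm cp x s) ((-κ * a) * cutoff κ cm cp r s) r ∧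
        HasDerivAt (fun x => cutoff κ cm cp r x) ((-κ * b) * cutoff κ cm cp r s) s := by
    intro f a b hf ha hb
    have hval : cutoff κ cm cp r s = Real.exp (-κ * f (r, s)) := by
      rw [cutoff, hf.self_of_nhds]
    constructor
    · have hev : (fun x => cutoff κ cm cp x s) =ᶠ[𝓝 r] fun x => Real.exp (-κ * f (x, s)) := by
        have hc : Tendsto (fun x : ℝ => (x, s)) (𝓝 r) (𝓝 (r, s)) :=
          (Continuous.tendsto (by fun_prop) r)
        filter_upwards [hc.eventually hf] with x hx
        rw [cutoff, hx]
      refine (((ha.const_mul (-κ)).exp).congr_of_eventuallyEq hev).congr_deriv ?_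
      rw [hval]; ring
    · have hev : (fun x => cutoff κ cm cp r x) =ᶠ[𝓝 s] fun x => Real.exp (-κ * f (r, x)) := by
        have hc : Tendsto (fun x : ℝ => (r, x)) (𝓝 s) (𝓝 (r, s)) :=
          (Continuous.tendsto (by fun_prop) s)
        filter_upwards [hc.eventually hf] with x hx
        rw [cutoff, hx]
      refine (((hb.const_mul (-κ)).exp).congr_of_eventuallyEq hev).congr_deriv ?_
      rw [hval]; ring
  have hpos : ∀ᶠ p : ℝ × ℝ in 𝓝 (r, s), 0 < p.2 :=
    (isOpen_lt continuous_const continuous_snd).mem_nhds hs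
  unfold cutoffR cutoffT
  split_ifs with h3 h4
  · have hev : ∀ᶠ p : ℝ × ℝ in 𝓝 (r, s), p.1 < cm * p.2 :=
      (isOpen_lt continuous_fst (by fun_prop)).mem_nhds h3
    convert key (fun p => cm * p.2 - p.1) (-1) cm ?_ ?_ ?_ using 3
    · ring
    · ring
    · filter_upwards [hev, hpos] with p hp hp0
      have : cm * p.2 ≤ cp * p.2 := mul_le_mul_of_nonneg_right h hp0.le
      rw [max_eq_left (a := cm * p.2 - p.1) (by linarith), max_eq_right (by linarith)]
    · simpa using (hasDerivAt_id r).const_sub (cm * s)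
    · simpa using ((hasDerivAt_id s).const_mul cm).sub_const r
  · have hev : ∀ᶠ p : ℝ × ℝ in 𝓝 (r, s), cm * p.2 < p.1 :=
      (isOpen_lt (by fun_prop) continuous_fst).mem_nhds (lt_of_le_of_ne (not_lt.1 h3) h1.symm)
    have hev' : ∀ᶠ p : ℝ × ℝ in 𝓝 (r, s), p.1 < cp * p.2 :=
      (isOpen_lt continuous_fst (by fun_prop)).mem_nhds h4
    convert key (fun _ => 0) 0 0 ?_ (hasDerivAt_const _ _) (hasDerivAt_const _ _) using 3
    · ring
    · ring
    · filter_upwards [hev, hev'] with p hp hp'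
      exact max_eq_left (max_le (by linarith) (by linarith))
  · have hev : ∀ᶠ p : ℝ × ℝ in 𝓝 (r, s), cp * p.2 < p.1 :=
      (isOpen_lt (by fun_prop) continuous_fst).mem_nhds (lt_of_le_of_ne (not_lt.1 h4) h2.symm)
    convert key (fun p => p.1 - cp * p.2) 1 (-cp) ?_ ?_ ?_ using 3
    · ring
    · ring
    · filter_upwards [hev, hpos] with p hp hp0
      have : cm * p.2 ≤ cp * p.2 := mul_le_mul_of_nonneg_right h hp0.le
      rw [max_eq_right (a := cm * p.2 - p.1) (by linarith), max_eq_right (by linarith)]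
    · simpa using (hasDerivAt_id r).sub_const (cp * s)
    · simpa using ((hasDerivAt_id s).const_mul cp).const_sub r

end Cutoff

/-! ### Regularity of radial solutions -/

/-- Interpolation of the first derivative between the function and its second derivative. -/
theorem mul_norm_deriv_le {f f' f'' : ℝ → Euc n} {r h ε M : ℝ} (hh : 0 < h)
    (hf : ∀ x, HasDerivAt f (f' x) x) (hf' : ∀ x, HasDerivAt f' (f'' x) x)
    (hε : ∀ x ≥ r, ‖f x‖ ≤ ε) (hM : ∀ x ≥ r, ‖f'' x‖ ≤ M) :
    h * ‖f' r‖ ≤ 2 * ε + M * h ^ 2 := by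
  have hM0 : 0 ≤ M := (norm_nonneg _).trans (hM r le_rfl)
  have hr : r ∈ Icc r (r + h) := ⟨le_rfl, by linarith⟩
  have hrh : r + h ∈ Icc r (r + h) := ⟨by linarith, le_rfl⟩
  have h1 : ∀ x ∈ Icc r (r + h), ‖f' x - f' r‖ ≤ M * h := fun x hx => by
    have := (convex_Icc r (r + h)).norm_image_sub_le_of_norm_hasDerivWithin_le
      (fun y _ => (hf' y).hasDerivWithinAt) (fun y hy => hM y hy.1) hr hx
    refine this.trans (mul_le_mul_of_nonneg_left ?_ hM0)
    rw [Real.norm_of_nonneg (by linarith [hx.1])]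
    linarith [hx.2]
  have h2 := (convex_Icc r (r + h)).norm_image_sub_le_of_norm_hasDerivWithin_le
    (f := fun x => f x - x • f' r) (f' := fun x => f' x - f' r)
    (fun y _ => by
      simpa using ((hf y).fun_sub ((hasDerivAt_id y).smul_const (f' r))).hasDerivWithinAt)
    h1 hr hrh
  have h3 : h • f' r = f (r + h) - f r - (f (r + h) - (r + h) • f' r - (f r - r • f' r)) := by
    module
  have h4 : ‖r + h - r‖ = h := by rw [add_sub_cancel_left, Real.norm_of_nonneg hh.le]
  rw [h4] at h2
  calc h * ‖f' r‖ = ‖h • f' r‖ := by rw [norm_smul, Real.norm_of_nonneg hh.le]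
    _ ≤ ‖f (r + h)‖ + ‖f r‖ + M * h * h := by
        rw [h3]
        exact (norm_sub_le _ _).trans (add_le_add (norm_sub_le _ _) h2)
    _ ≤ 2 * ε + M * h ^ 2 := by
        linarith [hε r le_rfl, hε (r + h) (by linarith)]

namespace IsRadialSolution

variable {d : ℕ} {V : Euc n → ℝ} {u : ℝ → ℝ → Euc n}

theorem exists_bound (h : IsRadialSolution d V u) :
    ∃ C, 0 ≤ C ∧ ∀ r t : ℝ, 0 ≤ r → 0 < t →
      ‖u r t‖ ≤ C ∧ ‖ur u r t‖ ≤ C ∧ ‖urr u r t‖ ≤ C ∧ ‖ut u r t‖ ≤ C := by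
  obtain ⟨C, hC⟩ := h.bounded
  have key : ∀ r t : ℝ, 0 ≤ r → 0 < t →
      ‖u r t‖ ≤ C ∧ ‖ur u r t‖ ≤ C ∧ ‖urr u r t‖ ≤ C ∧ ‖ut u r t‖ ≤ C := fun r t hr ht => by
    have := hC r t hr ht
    have h1 := norm_nonneg (u r t)
    have h2 := norm_nonneg (ur u r t)
    have h3 := norm_nonneg (urr u r t)
    have h4 := norm_nonneg (ut u r t)
    refine ⟨?_, ?_, ?_, ?_⟩ <;> linarith
  exact ⟨C, (norm_nonneg _).trans (key 0 1 le_rfl one_pos).1, key⟩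

theorem hasDerivAt_r (h : IsRadialSolution d V u) {t : ℝ} (ht : 0 < t) (r : ℝ) :
    HasDerivAt (fun x => u x t) (ur u r t) r := (h.diff_r t ht r).hasDerivAt

theorem hasDerivAt_rr (h : IsRadialSolution d V u) {t : ℝ} (ht : 0 < t) (r : ℝ) :
    HasDerivAt (fun x => ur u x t) (urr u r t) r := (h.diff_rr t ht r).hasDerivAt

theorem hasDerivAt_t (h : IsRadialSolution d V u) {t : ℝ} (ht : 0 < t) (r : ℝ) :
    HasDerivAt (fun x => u r x) (ut u r t) t := (h.diff_t t ht r).hasDerivAt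

theorem continuous_r (h : IsRadialSolution d V u) {t : ℝ} (ht : 0 < t) :
    Continuous fun r => u r t :=
  continuous_iff_continuousAt.2 fun r => (h.hasDerivAt_r ht r).continuousAt

theorem continuous_ur (h : IsRadialSolution d V u) {t : ℝ} (ht : 0 < t) :
    Continuous fun r => ur u r t :=
  continuous_iff_continuousAt.2 fun r => (h.hasDerivAt_rr ht r).continuousAt

theorem norm_sub_le (h : IsRadialSolution d V u) {C : ℝ} {r s t : ℝ}
    (hC : ∀ t > (0:ℝ), ‖ut u r t‖ ≤ C) (hs : 0 < s) (ht : 0 < t) :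
    ‖u r s - u r t‖ ≤ C * |s - t| :=
  (convex_Ioi (0:ℝ)).norm_image_sub_le_of_norm_hasDerivWithin_le
    (fun _ hx => (h.hasDerivAt_t hx r).hasDerivWithinAt) (fun x hx => hC x hx) ht hs

theorem tendsto_ur (h : IsRadialSolution d V u) {r t : ℝ} (hr : 0 ≤ r) (ht : 0 < t) :
    Tendsto (fun s => ur u r s) (𝓝 t) (𝓝 (ur u r t)) := by
  obtain ⟨C, hC0, hC⟩ := h.exists_bound
  rw [tendsto_iff_norm_sub_tendsto_zero]
  have hlim : Tendsto (fun s => 4 * C * √|s - t|) (𝓝 t) (𝓝 0) := by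
    have : Continuous fun s => 4 * C * √|s - t| := by fun_prop
    simpa using this.tendsto t
  refine squeeze_zero' (Eventually.of_forall fun _ => norm_nonneg _) ?_ hlim
  filter_upwards [eventually_gt_nhds ht] with s hs
  rcases eq_or_ne s t with rfl | hst
  · simp
  have hpos : 0 < |s - t| := abs_pos.2 (sub_ne_zero.2 hst)
  have hh : 0 < √|s - t| := Real.sqrt_pos.2 hpos
  have key := mul_norm_deriv_le (r := r) (ε := C * |s - t|) (M := 2 * C) hh
    (fun x => (h.hasDerivAt_r hs x).fun_sub (h.hasDerivAt_r ht x))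
    (fun x => (h.hasDerivAt_rr hs x).fun_sub (h.hasDerivAt_rr ht x))
    (fun x hx => h.norm_sub_le (fun t ht => (hC x t (hr.trans hx) ht).2.2.2) hs ht)
    (fun x hx => by
      refine (_root_.norm_sub_le _ _).trans ?_
      linarith [(hC x s (hr.trans hx) hs).2.2.1, (hC x t (hr.trans hx) ht).2.2.1])
  have hsq : √|s - t| ^ 2 = |s - t| := Real.sq_sqrt hpos.le
  refine le_of_mul_le_mul_left (key.trans (le_of_eq ?_)) hh
  rw [← hsq, Real.sqrt_sq hh.le]
  ring

theorem tendsto_urr (h : IsRadialSolution d V u) (hV : ContDiff ℝ 2 V) {r t : ℝ} (hr : 0 < r)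
    (ht : 0 < t) : Tendsto (fun s => urr u r s) (𝓝 t) (𝓝 (urr u r t)) := by
  have heq : ∀ s > (0:ℝ), urr u r s =
      ut u r s + gradient V (u r s) - (((d : ℝ) - 1) / r) • ur u r s := fun s hs => by
    rw [h.pde r hr s hs]
    abel
  have hut : Tendsto (fun s => ut u r s) (𝓝 t) (𝓝 (ut u r t)) :=
    (h.cont_t r).continuousAt (Ioi_mem_nhds ht)
  have hg : Tendsto (fun s => gradient V (u r s)) (𝓝 t) (𝓝 (gradient V (u r t))) :=
    ((contDiff_gradient hV).continuous.tendsto _).comp (h.hasDerivAt_t ht r).continuousAt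
  rw [heq t ht]
  refine ((hut.add hg).sub ((h.tendsto_ur hr.le ht).const_smul _)).congr' ?_
  filter_upwards [eventually_gt_nhds ht] with s hs using (heq s hs).symm

end IsRadialSolution

/-! ### Weighted integration by parts -/

theorem integrableOn_of_pow_exp_bound {κ a b : ℝ} (hκ : 0 < κ) {m : ℕ} {g : ℝ → ℝ}
    (hg : AEStronglyMeasurable g (volume.restrict (Ioi 0)))
    (hb : ∀ r > (0:ℝ), |g r| ≤ a * (r ^ m * Real.exp (-κ * r)) +
      b * (r ^ (m + 1) * Real.exp (-κ * r))) : IntegrableOn g (Ioi 0) := by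
  refine Integrable.mono' (((integrableOn_pow_mul_exp_neg hκ m).const_mul a).add
    ((integrableOn_pow_mul_exp_neg hκ (m + 1)).const_mul b)) hg ?_
  exact (ae_restrict_iff' measurableSet_Ioi).2 (Eventually.of_forall fun r hr => hb r hr)

/-- The space derivative of `r ^ (m + 1) * cutoff`. -/
def weightR (κ cm cp : ℝ) (m : ℕ) (t r : ℝ) : ℝ :=
  ((m + 1) * r ^ m + r ^ (m + 1) * cutoffR κ cm cp r t) * cutoff κ cm cp r t

section Parts

variable {κ cm cp t : ℝ}

theorem abs_weightR_le (hκ : 0 < κ) (hcp : 0 ≤ cp) (m : ℕ) {T r : ℝ} (hT : t ≤ T) (hr : 0 < r) :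
    |weightR κ cm cp m t r| ≤ ((m + 1) * r ^ m + r ^ (m + 1) * κ) *
      (Real.exp (κ * cp * T) * Real.exp (-κ * r)) := by
  rw [weightR, abs_mul, abs_of_pos (cutoff_pos r t)]
  refine mul_le_mul ?_ (cutoff_le hκ hcp hT r) (cutoff_pos r t).le (by positivity)
  refine (abs_add_le _ _).trans ?_
  rw [abs_mul (r ^ (m + 1)), abs_of_nonneg (a := ((m:ℝ) + 1) * r ^ m) (by positivity),
    abs_of_pos (pow_pos hr (m + 1))]
  gcongr
  exact abs_cutoffR_le hκ r t

/-- The divergence of `r ^ (m + 1) * cutoff * ⟪p, q⟫` integrates to zero over the half-line. -/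
theorem integral_weighted_divergence_eq_zero (hκ : 0 < κ) (hcm : 0 < cm) (hc : cm ≤ cp)
    (ht : 0 < t) (m : ℕ) {p q p' q' : ℝ → Euc n} {C : ℝ}
    (hp : ∀ r, HasDerivAt p (p' r) r) (hq : ∀ r, HasDerivAt q (q' r) r)
    (hpc : Continuous p') (hqc : Continuous q')
    (hC : ∀ r ≥ (0:ℝ), ‖p r‖ ≤ C ∧ ‖q r‖ ≤ C ∧ ‖p' r‖ ≤ C ∧ ‖q' r‖ ≤ C) :
    let f' := fun r => weightR κ cm cp m t r * ⟪p r, q r⟫ +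
      r ^ (m + 1) * cutoff κ cm cp r t * (⟪p r, q' r⟫ + ⟪p' r, q r⟫)
    IntegrableOn f' (Ioi 0) ∧ ∫ r in Ioi (0:ℝ), f' r = 0 := by
  intro f'
  have hcp : 0 ≤ cp := hcm.le.trans hc
  have hC0 : 0 ≤ C := (norm_nonneg _).trans (hC 0 le_rfl).1
  have hpcont : Continuous p := continuous_iff_continuousAt.2 fun r => (hp r).continuousAt
  have hqcont : Continuous q := continuous_iff_continuousAt.2 fun r => (hq r).continuousAt
  have hcut := continuous_cutoff (κ := κ) (cm := cm) (cp := cp) t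
  have inner_le : ∀ {x y : Euc n}, ‖x‖ ≤ C → ‖y‖ ≤ C → |⟪x, y⟫| ≤ C * C := fun hx hy =>
    (abs_real_inner_le_norm _ _).trans (mul_le_mul hx hy (norm_nonneg _) hC0)
  have hInt : IntegrableOn f' (Ioi 0) := by
    refine integrableOn_of_pow_exp_bound (m := m) hκ
      (a := (m + 1) * Real.exp (κ * cp * t) * (C * C))
      (b := (κ + 2) * Real.exp (κ * cp * t) * (C * C)) ?_ fun r hr => ?_
    · have hR : Measurable fun r => weightR κ cm cp m t r := by
        have := measurable_cutoffR (κ := κ) (cm := cm) (cp := cp) t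
        have := hcut.measurable
        unfold weightR
        fun_prop
      have h1 : Continuous fun r => ⟪p r, q r⟫ := hpcont.inner hqcont
      have h2 : Continuous fun r =>
          r ^ (m + 1) * cutoff κ cm cp r t * (⟪p r, q' r⟫ + ⟪p' r, q r⟫) :=
        (((continuous_pow _).mul hcut).mul ((hpcont.inner hqc).add (hpc.inner hqcont)))
      exact ((hR.mul h1.measurable).add h2.measurable).aestronglyMeasurable
    · obtain ⟨b1, b2, b3, b4⟩ := hC r hr.le
      have e1 : |weightR κ cm cp m t r * ⟪p r, q r⟫| ≤
          (((m + 1) * r ^ m + r ^ (m + 1) * κ) *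
            (Real.exp (κ * cp * t) * Real.exp (-κ * r))) * (C * C) := by
        rw [abs_mul]
        exact mul_le_mul (abs_weightR_le hκ hcp m le_rfl hr) (inner_le b1 b2) (abs_nonneg _)
          (by positivity)
      have e2 : |r ^ (m + 1) * cutoff κ cm cp r t * (⟪p r, q' r⟫ + ⟪p' r, q r⟫)| ≤
          r ^ (m + 1) * (Real.exp (κ * cp * t) * Real.exp (-κ * r)) * (C * C + C * C) := by
        rw [abs_mul, abs_mul, abs_of_pos (pow_pos hr (m + 1)), abs_of_pos (cutoff_pos r t)]
        have := cutoff_le (cm := cm) hκ hcp (le_refl t) r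
        have := (abs_add_le _ _).trans (add_le_add (inner_le b1 b4) (inner_le b3 b2))
        have := (cutoff_pos (κ := κ) (cm := cm) (cp := cp) r t).le
        gcongr
      refine ((abs_add_le _ _).trans (add_le_add e1 e2)).trans (le_of_eq ?_)
      ring
  refine ⟨hInt, ?_⟩
  refine integral_Ioi_eq_zero_of_hasDerivAt_off_countable
    (f := fun r => r ^ (m + 1) * cutoff κ cm cp r t * ⟪p r, q r⟫) (S := {cm * t, cp * t})
    (Set.toFinite _).countable (((continuous_pow _).mul hcut).mul (hpcont.inner hqcont))
    (fun r hr => ?_) hInt (by simp) ?_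
  · have hne : r ≠ cm * t ∧ r ≠ cp * t := by
      simpa [not_or] using hr.2
    have h1 := ((hasDerivAt_pow (m + 1) r).fun_mul
      (hasDerivAt_cutoff (κ := κ) hc ht hne.1 hne.2).1).fun_mul ((hp r).inner ℝ (hq r))
    refine h1.congr_deriv ?_
    simp only [f', weightR]
    push_cast
    ring
  · have hlim := (tendsto_pow_mul_exp_neg hκ (m + 1)).const_mul (Real.exp (κ * cp * t) * (C * C))
    rw [mul_zero] at hlim
    refine squeeze_zero_norm' ?_ hlim
    filter_upwards [eventually_gt_atTop (0:ℝ)] with r hr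
    obtain ⟨b1, b2, -, -⟩ := hC r hr.le
    rw [Real.norm_eq_abs, abs_mul, abs_mul, abs_of_pos (pow_pos hr (m + 1)),
      abs_of_pos (cutoff_pos r t)]
    calc r ^ (m + 1) * cutoff κ cm cp r t * |⟪p r, q r⟫|
        ≤ r ^ (m + 1) * (Real.exp (κ * cp * t) * Real.exp (-κ * r)) * (C * C) := by
          have := cutoff_le (cm := cm) hκ hcp (le_refl t) r
          have := inner_le b1 b2
          have := (cutoff_pos (κ := κ) (cm := cm) (cp := cp) r t).le
          gcongr
      _ = _ := by ring

end Parts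

/-! ### Time derivative of the firewall -/

/-- The density of the firewall functional. -/
def fireDensity (V : Euc n → ℝ) (u : ℝ → ℝ → Euc n) (r t : ℝ) : ℝ :=
  wV V * (‖ur u r t‖ ^ 2 / 2 + V (u r t)) + ‖u r t‖ ^ 2 / 2

/-- The integrand of the time derivative of the firewall functional. -/
def fireRate (V : Euc n → ℝ) (m : ℕ) (κ cm cp : ℝ) (u : ℝ → ℝ → Euc n) (t r : ℝ) : ℝ :=
  r ^ (m + 1) * (cutoffT κ cm cp r t * cutoff κ cm cp r t) * fireDensity V u r t +
    r ^ (m + 1) * cutoff κ cm cp r t *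
      (wV V * ⟪gradient V (u r t), ut u r t⟫ + ⟪u r t, ut u r t⟫) -
    wV V * (weightR κ cm cp m t r * ⟪ur u r t, ut u r t⟫ +
      r ^ (m + 1) * cutoff κ cm cp r t * ⟪urr u r t, ut u r t⟫)

theorem exists_potential_bound {V : Euc n → ℝ} (hV : ContDiff ℝ 2 V) (C : ℝ) :
    ∃ M, 0 ≤ M ∧ ∀ x : Euc n, ‖x‖ ≤ C → |V x| ≤ M ∧ ‖gradient V x‖ ≤ M := by
  obtain ⟨M₁, h₁⟩ := (isCompact_closedBall (0 : Euc n) C).exists_bound_of_continuousOn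
    hV.continuous.continuousOn
  obtain ⟨M₂, h₂⟩ := (isCompact_closedBall (0 : Euc n) C).exists_bound_of_continuousOn
    (contDiff_gradient hV).continuous.continuousOn
  refine ⟨max 0 (max M₁ M₂), le_max_left _ _, fun x hx => ⟨?_, ?_⟩⟩
  · exact (h₁ x (by simpa using hx)).trans ((le_max_left _ _).trans (le_max_right _ _))
  · exact (h₂ x (by simpa using hx)).trans ((le_max_right _ _).trans (le_max_right _ _))

section Rate

variable {V : Euc n → ℝ} {m : ℕ} {κ cm cp : ℝ} {u : ℝ → ℝ → Euc n}

theorem FSF_eq_cutoff (h : cm ≤ cp) {s : ℝ} (hs : 0 ≤ s) :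
    FSF V (m + 2) κ cm cp u s =
      ∫ r in Ioi (0:ℝ), r ^ (m + 1) * cutoff κ cm cp r s * fireDensity V u r s := by
  unfold FSF fireDensity
  refine integral_congr_ae (Eventually.of_forall fun r => ?_)
  simp only [psiSF_eq_cutoff (m + 2) h hs r]
  rfl

theorem IsRadialSolution.exists_fireDensity_bound (hu : IsRadialSolution (m + 2) V u)
    (hV : ContDiff ℝ 2 V) :
    ∃ G, 0 ≤ G ∧ ∀ r s : ℝ, 0 ≤ r → 0 < s → |fireDensity V u r s| ≤ G := by
  obtain ⟨C, hC0, hC⟩ := hu.exists_bound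
  obtain ⟨M, hM0, hM⟩ := exists_potential_bound hV C
  have hw := wV_pos V
  refine ⟨wV V * (C ^ 2 / 2 + M) + C ^ 2 / 2, by positivity, fun r s hr hs => ?_⟩
  obtain ⟨b1, b2, -, -⟩ := hC r s hr hs
  have h1 := (hM _ b1).1
  have h2 : ‖u r s‖ ^ 2 ≤ C ^ 2 := by gcongr
  have h3 : ‖ur u r s‖ ^ 2 ≤ C ^ 2 := by gcongr
  calc |fireDensity V u r s|
      ≤ |wV V * (‖ur u r s‖ ^ 2 / 2 + V (u r s))| + |‖u r s‖ ^ 2 / 2| := abs_add_le _ _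
    _ ≤ wV V * (‖ur u r s‖ ^ 2 / 2 + |V (u r s)|) + ‖u r s‖ ^ 2 / 2 := by
        rw [abs_mul, abs_of_pos hw, abs_of_nonneg (a := ‖u r s‖ ^ 2 / 2) (by positivity)]
        gcongr
        refine (abs_add_le _ _).trans ?_
        rw [abs_of_nonneg (a := ‖ur u r s‖ ^ 2 / 2) (by positivity)]
    _ ≤ _ := by gcongr

theorem IsRadialSolution.continuous_fireDensity (hu : IsRadialSolution (m + 2) V u)
    (hV : ContDiff ℝ 2 V) {s : ℝ} (hs : 0 < s) : Continuous fun r => fireDensity V u r s := by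
  have h1 := hu.continuous_r hs
  have h2 := hu.continuous_ur hs
  have h3 := hV.continuous
  unfold fireDensity
  fun_prop

theorem IsRadialSolution.integrableOn_fire (hu : IsRadialSolution (m + 2) V u)
    (hV : ContDiff ℝ 2 V) (hκ : 0 < κ) (hcp : 0 ≤ cp) {s : ℝ} (hs : 0 < s) :
    IntegrableOn (fun r => r ^ (m + 1) * cutoff κ cm cp r s * fireDensity V u r s) (Ioi 0) := by
  obtain ⟨G, hG0, hG⟩ := hu.exists_fireDensity_bound hV
  refine integrableOn_of_pow_exp_bound (m := m) hκ (a := 0) (b := Real.exp (κ * cp * s) * G)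
    ?_ fun r hr => ?_
  · exact (((continuous_pow _).mul (continuous_cutoff s)).mul
      (hu.continuous_fireDensity hV hs)).aestronglyMeasurable
  · rw [abs_mul, abs_mul, abs_of_pos (pow_pos hr _), abs_of_pos (cutoff_pos r s)]
    have h1 := cutoff_le (cm := cm) hκ hcp (le_refl s) r
    have h2 := hG r s hr.le hs
    have h3 := (cutoff_pos (κ := κ) (cm := cm) (cp := cp) r s).le
    calc r ^ (m + 1) * cutoff κ cm cp r s * |fireDensity V u r s|
        ≤ r ^ (m + 1) * (Real.exp (κ * cp * s) * Real.exp (-κ * r)) * G := by gcongr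
      _ = _ := by ring

theorem IsRadialSolution.hasDerivAt_potential (hu : IsRadialSolution (m + 2) V u)
    (hV : ContDiff ℝ 2 V) (r : ℝ) {s : ℝ} (hs : 0 < s) :
    HasDerivAt (fun s => wV V * V (u r s) + ‖u r s‖ ^ 2 / 2)
      (wV V * ⟪gradient V (u r s), ut u r s⟫ + ⟪u r s, ut u r s⟫) s := by
  have h1 := (hasDerivAt_comp_gradient (hV.differentiable (by norm_num))
    (hu.hasDerivAt_t hs r)).const_mul (wV V)
  have h2 := ((hu.hasDerivAt_t hs r).norm_sq).div_const 2
  refine (h1.fun_add h2).congr_deriv ?_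
  ring

/-- The firewall is differentiable in time, although `u_r` need not be: the difference quotient
of the gradient term is integrated by parts before passing to the limit. -/
theorem IsRadialSolution.hasDerivAt_FSF (hu : IsRadialSolution (m + 2) V u)
    (hV : ContDiff ℝ 2 V) (hκ : 0 < κ) (hcm : 0 < cm) (hc : cm ≤ cp) {t : ℝ} (ht : 0 < t) :
    IntegrableOn (fireRate V m κ cm cp u t) (Ioi 0) ∧
      HasDerivAt (FSF V (m + 2) κ cm cp u) (∫ r in Ioi (0:ℝ), fireRate V m κ cm cp u t r) t := by
  have hcp : 0 ≤ cp := hcm.le.trans hc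
  have hw := wV_pos V
  obtain ⟨C, hC0, hC⟩ := hu.exists_bound
  obtain ⟨M, hM0, hM⟩ := exists_potential_bound hV C
  obtain ⟨G, hG0, hG⟩ := hu.exists_fireDensity_bound hV
  set divg : ℝ → ℝ → ℝ := fun s r =>
    weightR κ cm cp m t r * ⟪ur u r s + ur u r t, u r s - u r t⟫ +
      r ^ (m + 1) * cutoff κ cm cp r t * (⟪ur u r s + ur u r t, ur u r s - ur u r t⟫ +
        ⟪urr u r s + urr u r t, u r s - u r t⟫) with hdivg
  have hdiv : ∀ s > (0:ℝ), IntegrableOn (divg s) (Ioi 0) ∧ ∫ r in Ioi (0:ℝ), divg s r = 0 :=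
    fun s hs => integral_weighted_divergence_eq_zero (C := 2 * C) hκ hcm hc ht m
      (fun r => (hu.hasDerivAt_rr hs r).fun_add (hu.hasDerivAt_rr ht r))
      (fun r => (hu.hasDerivAt_r hs r).fun_sub (hu.hasDerivAt_r ht r))
      ((hu.cont_rr s hs).add (hu.cont_rr t ht))
      ((hu.continuous_ur hs).sub (hu.continuous_ur ht)) fun r hr => by
        obtain ⟨a1, a2, a3, -⟩ := hC r s hr hs
        obtain ⟨b1, b2, b3, -⟩ := hC r t hr ht
        exact ⟨(norm_add_le _ _).trans (by linarith), (_root_.norm_sub_le _ _).trans (by linarith),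
          (norm_add_le _ _).trans (by linarith), (_root_.norm_sub_le _ _).trans (by linarith)⟩
  have hInt : ∀ s > (0:ℝ), IntegrableOn
      (fun r => r ^ (m + 1) * cutoff κ cm cp r s * fireDensity V u r s) (Ioi 0) :=
    fun s hs => hu.integrableOn_fire hV hκ hcp hs
  set H : ℝ → ℝ → ℝ := fun s r => (s - t)⁻¹ *
    (r ^ (m + 1) * cutoff κ cm cp r s * fireDensity V u r s -
      r ^ (m + 1) * cutoff κ cm cp r t * fireDensity V u r t - wV V / 2 * divg s r) with hH
  have hHint : ∀ s > (0:ℝ), IntegrableOn (H s) (Ioi 0) := fun s hs =>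
    (((hInt s hs).sub (hInt t ht)).sub ((hdiv s hs).1.const_mul _)).const_mul _
  have hslope : ∀ s > (0:ℝ), slope (FSF V (m + 2) κ cm cp u) t s = ∫ r in Ioi (0:ℝ), H s r := by
    intro s hs
    have h12 : IntegrableOn (fun r => r ^ (m + 1) * cutoff κ cm cp r s * fireDensity V u r s -
      r ^ (m + 1) * cutoff κ cm cp r t * fireDensity V u r t) (Ioi 0) := (hInt s hs).sub (hInt t ht)
    rw [slope_def_field, FSF_eq_cutoff hc hs.le, FSF_eq_cutoff hc ht.le, hH,
      integral_const_mul, integral_sub h12 ((hdiv s hs).1.const_mul _),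
      integral_sub (hInt s hs) (hInt t ht), integral_const_mul, (hdiv s hs).2]
    ring
  have hform : ∀ s r : ℝ, H s r =
      r ^ (m + 1) * ((s - t)⁻¹ * (cutoff κ cm cp r s - cutoff κ cm cp r t)) *
          fireDensity V u r s +
        r ^ (m + 1) * cutoff κ cm cp r t * ((s - t)⁻¹ *
          ((wV V * V (u r s) + ‖u r s‖ ^ 2 / 2) - (wV V * V (u r t) + ‖u r t‖ ^ 2 / 2))) -
        wV V / 2 * (weightR κ cm cp m t r *
            ⟪ur u r s + ur u r t, (s - t)⁻¹ • (u r s - u r t)⟫ +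
          r ^ (m + 1) * cutoff κ cm cp r t *
            ⟪urr u r s + urr u r t, (s - t)⁻¹ • (u r s - u r t)⟫) := by
    intro s r
    have hsq : ⟪ur u r s + ur u r t, ur u r s - ur u r t⟫ = ‖ur u r s‖ ^ 2 - ‖ur u r t‖ ^ 2 := by
      rw [inner_add_left, inner_sub_right, inner_sub_right, real_inner_self_eq_norm_sq,
        real_inner_self_eq_norm_sq, real_inner_comm (ur u r s) (ur u r t)]
      ring
    simp only [hH, hdivg, hsq, real_inner_smul_right, fireDensity]
    ring
  set P : ℝ := wV V * (M * C) + C * C with hP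
  have hbound : ∀ s > (0:ℝ), s ≤ 2 * t → s ≠ t → ∀ r > (0:ℝ), |H s r| ≤
      wV V / 2 * (m + 1) * (2 * C * C) * Real.exp (κ * cp * (2 * t)) *
          (r ^ m * Real.exp (-κ * r)) +
        (κ * cp * G + P + wV V / 2 * (κ + 1) * (2 * C * C)) * Real.exp (κ * cp * (2 * t)) *
          (r ^ (m + 1) * Real.exp (-κ * r)) := by
    intro s hs hs2 hst r hr
    have hpos : 0 < |s - t| := abs_pos.2 (sub_ne_zero.2 hst)
    have hcancel : ∀ {x a : ℝ}, x ≤ a * |s - t| → |s - t|⁻¹ * x ≤ a := fun {x a} hx => by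
      rw [inv_mul_le_iff₀ hpos, mul_comm]
      exact hx
    set Q := Real.exp (κ * cp * (2 * t)) * Real.exp (-κ * r) with hQ
    have hQ0 : 0 < Q := by positivity
    have hcutQ : cutoff κ cm cp r t ≤ Q := cutoff_le hκ hcp (by linarith) r
    have hcut0 := (cutoff_pos (κ := κ) (cm := cm) (cp := cp) r t).le
    have e1 : |(s - t)⁻¹ * (cutoff κ cm cp r s - cutoff κ cm cp r t)| ≤ κ * cp * Q := by
      rw [abs_mul, abs_inv]
      refine hcancel ((abs_cutoff_sub_le hκ hcm.le hc hs2 (by linarith) r).trans (le_of_eq ?_))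
      ring
    have e2 : |(s - t)⁻¹ * ((wV V * V (u r s) + ‖u r s‖ ^ 2 / 2) -
        (wV V * V (u r t) + ‖u r t‖ ^ 2 / 2))| ≤ P := by
      rw [abs_mul, abs_inv]
      refine hcancel ((convex_Ioi (0:ℝ)).norm_image_sub_le_of_norm_hasDerivWithin_le
        (fun x hx => (hu.hasDerivAt_potential hV r hx).hasDerivWithinAt) (fun x hx => ?_) ht hs)
      obtain ⟨b1, -, -, b4⟩ := hC r x hr.le hx
      refine (norm_add_le _ _).trans ?_
      rw [norm_mul, Real.norm_of_nonneg hw.le, hP]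
      have := (hM _ b1).2
      gcongr
      · exact (norm_inner_le_norm _ _).trans (by gcongr)
      · exact (norm_inner_le_norm _ _).trans (by gcongr)
    have e3 : ‖(s - t)⁻¹ • (u r s - u r t)‖ ≤ C := by
      rw [norm_smul, norm_inv]
      exact hcancel (hu.norm_sub_le (fun x hx => (hC r x hr.le hx).2.2.2) hs ht)
    obtain ⟨-, a2, a3, -⟩ := hC r s hr.le hs
    obtain ⟨-, b2, b3, -⟩ := hC r t hr.le ht
    have e4 : |⟪ur u r s + ur u r t, (s - t)⁻¹ • (u r s - u r t)⟫| ≤ 2 * C * C := by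
      refine (abs_real_inner_le_norm _ _).trans (mul_le_mul ?_ e3 (norm_nonneg _) (by positivity))
      exact (norm_add_le _ _).trans (by linarith)
    have e5 : |⟪urr u r s + urr u r t, (s - t)⁻¹ • (u r s - u r t)⟫| ≤ 2 * C * C := by
      refine (abs_real_inner_le_norm _ _).trans (mul_le_mul ?_ e3 (norm_nonneg _) (by positivity))
      exact (norm_add_le _ _).trans (by linarith)
    have e6 := abs_weightR_le (cm := cm) hκ hcp m (show t ≤ 2 * t by linarith) hr
    have e7 := hG r s hr.le hs
    rw [hform]
    have hrp : 0 < r ^ (m + 1) := pow_pos hr _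
    refine (abs_sub _ _).trans ((add_le_add (abs_add_le _ _) le_rfl).trans ?_)
    rw [abs_mul (wV V / 2), abs_of_pos (show 0 < wV V / 2 by positivity)]
    refine (add_le_add (add_le_add (b := r ^ (m + 1) * (κ * cp * Q) * G)
      (d := r ^ (m + 1) * Q * P) ?_ ?_) (mul_le_mul_of_nonneg_left ((abs_add_le _ _).trans
        (add_le_add (b := ((m + 1) * r ^ m + r ^ (m + 1) * κ) * Q * (2 * C * C))
          (d := r ^ (m + 1) * Q * (2 * C * C)) ?_ ?_)) (by positivity))).trans (le_of_eq ?_)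
    · rw [abs_mul, abs_mul, abs_of_pos hrp]
      gcongr
    · rw [abs_mul, abs_mul, abs_of_pos hrp, abs_of_nonneg hcut0]
      gcongr
    · rw [abs_mul]
      gcongr
    · rw [abs_mul, abs_mul, abs_of_pos hrp, abs_of_nonneg hcut0]
      gcongr
    · rw [hQ]
      ring
  have hpt : ∀ r > (0:ℝ), r ≠ cm * t → r ≠ cp * t →
      Tendsto (fun s => H s r) (𝓝[≠] t) (𝓝 (fireRate V m κ cm cp u t r)) := by
    intro r hr hr1 hr2
    have t1 : Tendsto (fun s => (s - t)⁻¹ * (cutoff κ cm cp r s - cutoff κ cm cp r t)) (𝓝[≠] t)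
        (𝓝 (cutoffT κ cm cp r t * cutoff κ cm cp r t)) :=
      hasDerivAt_iff_tendsto_slope.1 (hasDerivAt_cutoff hc ht hr1 hr2).2
    have t2 : Tendsto (fun s => (s - t)⁻¹ * ((wV V * V (u r s) + ‖u r s‖ ^ 2 / 2) -
        (wV V * V (u r t) + ‖u r t‖ ^ 2 / 2))) (𝓝[≠] t)
        (𝓝 (wV V * ⟪gradient V (u r t), ut u r t⟫ + ⟪u r t, ut u r t⟫)) :=
      hasDerivAt_iff_tendsto_slope.1 (hu.hasDerivAt_potential hV r ht)
    have t3 : Tendsto (fun s => (s - t)⁻¹ • (u r s - u r t)) (𝓝[≠] t) (𝓝 (ut u r t)) :=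
      hasDerivAt_iff_tendsto_slope.1 (hu.hasDerivAt_t ht r)
    have hle : 𝓝[≠] t ≤ 𝓝 t := nhdsWithin_le_nhds
    have t4 := (hu.tendsto_ur hr.le ht).mono_left hle
    have t5 := (hu.tendsto_urr hV hr ht).mono_left hle
    have t6 : Tendsto (fun s => u r s) (𝓝[≠] t) (𝓝 (u r t)) :=
      Tendsto.mono_left (hu.hasDerivAt_t ht r).continuousAt hle
    have t7 : Tendsto (fun s => fireDensity V u r s) (𝓝[≠] t) (𝓝 (fireDensity V u r t)) := by
      unfold fireDensity
      exact ((((t4.norm.pow 2).div_const 2).add ((hV.continuous.tendsto _).comp t6)).const_mul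
        _).add ((t6.norm.pow 2).div_const 2)
    have t8 := ((t1.const_mul (r ^ (m + 1))).mul t7).add
      (t2.const_mul (r ^ (m + 1) * cutoff κ cm cp r t))
    have t9 := ((((t4.add_const (ur u r t)).inner t3).const_mul (weightR κ cm cp m t r)).add
      (((t5.add_const (urr u r t)).inner t3).const_mul
        (r ^ (m + 1) * cutoff κ cm cp r t))).const_mul (wV V / 2)
    simp only [hform]
    convert t8.sub t9 using 2
    simp only [fireRate, inner_add_left]
    ring
  have hae : ∀ᵐ r ∂(volume.restrict (Ioi (0:ℝ))),
      Tendsto (fun s => H s r) (𝓝[≠] t) (𝓝 (fireRate V m κ cm cp u t r)) := by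
    have hn : ∀ a : ℝ, ∀ᵐ r ∂(volume.restrict (Ioi (0:ℝ))), r ≠ a := fun a =>
      ae_restrict_of_ae (by simp [ae_iff])
    filter_upwards [ae_restrict_mem measurableSet_Ioi, hn (cm * t), hn (cp * t)] with r h1 h2 h3
    exact hpt r h1 h2 h3
  have hnear : ∀ᶠ s in 𝓝[≠] t, 0 < s ∧ s ≤ 2 * t ∧ s ≠ t := by
    filter_upwards [nhdsWithin_le_nhds (eventually_gt_nhds ht),
      nhdsWithin_le_nhds (eventually_le_nhds (show t < 2 * t by linarith)),
      self_mem_nhdsWithin] with s h1 h2 h3 using ⟨h1, h2, h3⟩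
  obtain ⟨hL, hT⟩ := tendsto_integral_and_integrable_of_dominated
    (hnear.mono fun s hs => (hHint s hs.1).aestronglyMeasurable)
    (hnear.mono fun s hs => (ae_restrict_iff' measurableSet_Ioi).2
      (Eventually.of_forall fun r hr => hbound s hs.1 hs.2.1 hs.2.2 r hr))
    (((integrableOn_pow_mul_exp_neg hκ m).const_mul _).add
      ((integrableOn_pow_mul_exp_neg hκ (m + 1)).const_mul _)) hae
  refine ⟨hL, hasDerivAt_iff_tendsto_slope.2 (hT.congr' ?_)⟩
  filter_upwards [hnear] with s hs using (hslope s hs.1).symm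

end Rate

/-! ### The differential inequality -/

theorem weightR_eq (κ cm cp : ℝ) (m : ℕ) (t : ℝ) {r : ℝ} (hr : 0 < r) :
    weightR κ cm cp m t r =
      r ^ (m + 1) * cutoff κ cm cp r t * ((m + 1) / r + cutoffR κ cm cp r t) := by
  rw [weightR]
  field_simp
  ring

/-- Pointwise bound of the rate of the firewall, after subtraction of a divergence. -/
theorem fireRate_sub_divergence_le {V : Euc n → ℝ} {m : ℕ} {κ cm cp ν t r : ℝ}
    {u : ℝ → ℝ → Euc n} (hu : IsRadialSolution (m + 2) V u)
    (hVw : ∀ x, -(‖x‖ ^ 2 / 4) ≤ wV V * V x) (hκ : 0 < κ) (hcm : 0 < cm) (hc : cm ≤ cp)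
    (hsmall : κ * cp * wV V + wV V * κ ^ 2 + κ ≤ 1) (hν : ν * wV V ≤ 1)
    (ht : 0 < t) (hr : 0 < r) :
    fireRate V m κ cm cp u t r -
        (weightR κ cm cp m t r * ⟪u r t, ur u r t⟫ + r ^ (m + 1) * cutoff κ cm cp r t *
          (⟪u r t, urr u r t⟫ + ⟪ur u r t, ur u r t⟫)) +
        ν * (r ^ (m + 1) * cutoff κ cm cp r t * fireDensity V u r t) ≤
      r ^ (m + 1) * cutoff κ cm cp r t *
        (-⟪u r t, gradient V (u r t)⟫ + κ * cp * wV V * V (u r t) +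
          κ * (cp + 1) / 2 * ‖u r t‖ ^ 2 + ν * (wV V * V (u r t) + ‖u r t‖ ^ 2 / 2)) := by
  have hw := wV_pos V
  have hpde := hu.pde r hr t ht
  have hcast : (((m + 2 : ℕ) : ℝ) - 1) = m + 1 := by push_cast; ring
  rw [hcast] at hpde
  set ψ := r ^ (m + 1) * cutoff κ cm cp r t with hψ
  have hψ0 : 0 ≤ ψ := mul_nonneg (pow_pos hr _).le (cutoff_pos r t).le
  set e := cutoffR κ cm cp r t with he
  set τ := cutoffT κ cm cp r t with hτ
  have he' : |e| ≤ κ := abs_cutoffR_le hκ r t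
  have hτ' : τ ≤ κ * cp := cutoffT_le hκ hcm.le hc r t
  set ρ : ℝ := (m + 1) / r with hρ
  set a := u r t
  set b := ur u r t
  set c := urr u r t
  set y := ut u r t
  set g := gradient V a
  have hay : ⟪a, y⟫ = -⟪a, g⟫ + ρ * ⟪a, b⟫ + ⟪a, c⟫ := by
    rw [hpde, inner_add_right, inner_add_right, inner_neg_right, real_inner_smul_right]
  have hyy : ‖y‖ ^ 2 = -⟪g, y⟫ + ρ * ⟪b, y⟫ + ⟪c, y⟫ := by
    rw [← real_inner_self_eq_norm_sq]
    conv_lhs => enter [2]; rw [hpde]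
    rw [inner_add_left, inner_add_left, inner_neg_left, real_inner_smul_left]
  have hdens : fireDensity V u r t = wV V * (‖b‖ ^ 2 / 2 + V a) + ‖a‖ ^ 2 / 2 := rfl
  have hdens0 : 0 ≤ fireDensity V u r t := by
    rw [hdens]
    nlinarith [hVw a, mul_nonneg hw.le (sq_nonneg ‖b‖), sq_nonneg ‖a‖]
  have hby : -(e * ⟪b, y⟫) ≤ κ * (‖b‖ * ‖y‖) := by
    refine (neg_le_abs _).trans ?_
    rw [abs_mul]
    exact mul_le_mul he' (abs_real_inner_le_norm _ _) (abs_nonneg _) hκ.le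
  have hab : -(e * ⟪a, b⟫) ≤ κ * (‖a‖ * ‖b‖) := by
    refine (neg_le_abs _).trans ?_
    rw [abs_mul]
    exact mul_le_mul he' (abs_real_inner_le_norm _ _) (abs_nonneg _) hκ.le
  have hexpand : fireRate V m κ cm cp u t r -
        (weightR κ cm cp m t r * ⟪a, b⟫ + ψ * (⟪a, c⟫ + ⟪b, b⟫)) +
        ν * (ψ * fireDensity V u r t) =
      ψ * (τ * fireDensity V u r t - wV V * ‖y‖ ^ 2 + wV V * -(e * ⟪b, y⟫) - ⟪a, g⟫ +
        -(e * ⟪a, b⟫) - ‖b‖ ^ 2 + ν * fireDensity V u r t) := by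
    rw [fireRate, weightR_eq κ cm cp m t hr, hay, hyy, real_inner_self_eq_norm_sq]
    ring
  rw [hexpand]
  refine mul_le_mul_of_nonneg_left ?_ hψ0
  have h1 : τ * fireDensity V u r t ≤ κ * cp * fireDensity V u r t :=
    mul_le_mul_of_nonneg_right hτ' hdens0
  have h2 : wV V * -(e * ⟪b, y⟫) ≤ wV V * (‖y‖ ^ 2 + κ ^ 2 * ‖b‖ ^ 2 / 4) := by
    refine mul_le_mul_of_nonneg_left (hby.trans ?_) hw.le
    nlinarith [sq_nonneg (‖y‖ - κ * ‖b‖ / 2)]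
  have h3 : κ * (‖a‖ * ‖b‖) ≤ κ * (‖a‖ ^ 2 / 2 + ‖b‖ ^ 2 / 2) :=
    mul_le_mul_of_nonneg_left (by nlinarith [sq_nonneg (‖a‖ - ‖b‖)]) hκ.le
  have h4 : (κ * cp * wV V / 2 + wV V * κ ^ 2 / 4 + κ / 2 + ν * wV V / 2) * ‖b‖ ^ 2 ≤
      1 * ‖b‖ ^ 2 := by
    refine mul_le_mul_of_nonneg_right ?_ (sq_nonneg _)
    linarith [mul_nonneg hw.le (sq_nonneg κ)]
  rw [hdens] at h1 ⊢
  linarith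

/-- The potential part of the firewall rate is nonpositive close to the origin, and bounded
elsewhere. -/
theorem exists_pollution_bound {V : Euc n → ℝ} (hn : 1 ≤ n) (hV : ContDiff ℝ 2 V)
    (D : EscData n V) (h0 : (0 : Euc n) ∈ MinSet V) (hV0 : V 0 = 0) {ν : ℝ} (hν0 : 0 ≤ ν)
    (hν : ν * (wV V * D.lmax + 1 / 2) ≤ D.lmin / 4) (R : ℝ) :
    ∃ K ≥ (0:ℝ), ∀ κ cp : ℝ, 0 < κ → 0 < cp → κ * cp * wV V ≤ D.lmin / (8 * D.lmax) →
      κ * (cp + 1) ≤ D.lmin / 4 → ∀ x : Euc n, ‖x‖ ≤ R →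
        -⟪x, gradient V x⟫ + κ * cp * wV V * V x + κ * (cp + 1) / 2 * ‖x‖ ^ 2 +
          ν * (wV V * V x + ‖x‖ ^ 2 / 2) ≤ if D.dEsc < ‖x‖ then K else 0 := by
  have hw := wV_pos V
  have hl := D.lmin_pos
  have hL : 0 < D.lmax := hl.trans_le (D.lmin_le_lmax hn h0)
  obtain ⟨M, hM0, hM⟩ := exists_potential_bound hV |R|
  refine ⟨|R| * M + D.lmin / (8 * D.lmax) * M + D.lmin / 4 / 2 * |R| ^ 2 +
    ν * (wV V * M + |R| ^ 2 / 2), by positivity, fun κ cp hκ hcp h1 h2 x hx => ?_⟩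
  have hxR : ‖x‖ ≤ |R| := hx.trans (le_abs_self R)
  have hcw : 0 < κ * cp * wV V := by positivity
  split_ifs with hesc
  · obtain ⟨m1, m2⟩ := hM x hxR
    have e1 : -⟪x, gradient V x⟫ ≤ |R| * M := by
      refine (neg_le_abs _).trans ((abs_real_inner_le_norm _ _).trans ?_)
      gcongr
    have e2 : V x ≤ M := (le_abs_self _).trans m1
    have e3 : κ * cp * wV V * V x ≤ D.lmin / (8 * D.lmax) * M :=
      (mul_le_mul_of_nonneg_left e2 hcw.le).trans (mul_le_mul_of_nonneg_right h1 hM0)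
    gcongr
  · obtain ⟨g1, g2, g3⟩ := D.near_min hV h0 (x := x) (by simpa using not_lt.1 hesc)
    simp only [sub_zero, hV0] at g1 g2 g3
    rw [real_inner_comm] at g1
    have hx2 : 0 ≤ ‖x‖ ^ 2 := sq_nonneg _
    have e1 : κ * cp * wV V * V x ≤ D.lmin / 8 * ‖x‖ ^ 2 :=
      calc κ * cp * wV V * V x ≤ κ * cp * wV V * (D.lmax * ‖x‖ ^ 2) := by gcongr
        _ ≤ D.lmin / (8 * D.lmax) * (D.lmax * ‖x‖ ^ 2) := by gcongr
        _ = _ := by field_simp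
    have e2 : κ * (cp + 1) / 2 * ‖x‖ ^ 2 ≤ D.lmin / 4 / 2 * ‖x‖ ^ 2 := by gcongr
    have e3 : ν * (wV V * V x + ‖x‖ ^ 2 / 2) ≤ D.lmin / 4 * ‖x‖ ^ 2 :=
      calc ν * (wV V * V x + ‖x‖ ^ 2 / 2)
          ≤ ν * (wV V * (D.lmax * ‖x‖ ^ 2) + ‖x‖ ^ 2 / 2) := by gcongr
        _ = ν * (wV V * D.lmax + 1 / 2) * ‖x‖ ^ 2 := by ring
        _ ≤ _ := by gcongr
    linarith

/-- firewall decrease up to pollution term, standing frame. -/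
theorem stmt18 {n d k : ℕ} (hn : 1 ≤ n) (hd : 2 ≤ d) (hk : 2 ≤ k)
    (V : Euc n → ℝ) (hV : ContDiff ℝ (k : ℕ∞) V) (hcoerc : HCoerc V)
    (D : EscData n V) (h0 : (0 : Euc n) ∈ MinSet V) (hV0 : V 0 = 0)
    (R : ℝ) :
    ∃ K' ≥ (0:ℝ),
      ∀ κ cm cp : ℝ, 0 < κ → 0 < cm → cm ≤ cp →
        κ * cp * wV V + wV V * κ ^ 2 + κ ≤ 1 →
        κ * cp * wV V ≤ D.lmin / (8 * D.lmax) →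
        κ * (cp + 1) ≤ D.lmin / 4 →
        ∀ u : ℝ → ℝ → Euc n, IsRadialSolution d V u →
          (∀ r t : ℝ, 0 ≤ r → 0 ≤ t → ‖u r t‖ ≤ R) →
          ∀ t > (0:ℝ),
            DifferentiableAt ℝ (FSF V d κ cm cp u) t ∧
            deriv (FSF V d κ cm cp u) t ≤
              -(min (1 / wV V) (D.lmin / (4 * (wV V * D.lmax + 1 / 2)))) *
                FSF V d κ cm cp u t +
              K' * ∫ r in Sigma0 u D.dEsc t, psiSF d κ cm cp r t := by
  have hV2 : ContDiff ℝ 2 V := hV.of_le (WithTop.coe_le_coe.2 (Nat.cast_le.2 hk))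
  have hw := wV_pos V
  have hl := D.lmin_pos
  have hL : 0 < D.lmax := hl.trans_le (D.lmin_le_lmax hn h0)
  set ν := min (1 / wV V) (D.lmin / (4 * (wV V * D.lmax + 1 / 2))) with hν
  have hν0 : 0 ≤ ν := le_min (by positivity) (by positivity)
  have hν1 : ν * wV V ≤ 1 := (le_div_iff₀ hw).1 (min_le_left _ _)
  have hν2 : ν * (wV V * D.lmax + 1 / 2) ≤ D.lmin / 4 := by
    have h := (le_div_iff₀ (show 0 < 4 * (wV V * D.lmax + 1 / 2) by positivity)).1
      (hν ▸ min_le_right (1 / wV V) (D.lmin / (4 * (wV V * D.lmax + 1 / 2))))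
    linarith
  obtain ⟨K, hK0, hK⟩ := exists_pollution_bound hn hV2 D h0 hV0 hν0 hν2 R
  refine ⟨K, hK0, fun κ cm cp hκ hcm hc hs1 hs2 hs3 u hu huR t ht => ?_⟩
  obtain ⟨m, rfl⟩ : ∃ m, d = m + 2 := ⟨d - 2, by omega⟩
  have hcp : 0 < cp := hcm.trans_le hc
  obtain ⟨hInt, hderiv⟩ := hu.hasDerivAt_FSF hV2 hκ hcm hc ht
  refine ⟨hderiv.differentiableAt, ?_⟩
  obtain ⟨C, -, hC⟩ := hu.exists_bound
  obtain ⟨hdivint, hdiv⟩ := integral_weighted_divergence_eq_zero hκ hcm hc ht m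
    (hu.hasDerivAt_r ht) (hu.hasDerivAt_rr ht) (hu.continuous_ur ht) (hu.cont_rr t ht)
    (C := C) fun r hr =>
      ⟨(hC r t hr ht).1, (hC r t hr ht).2.1, (hC r t hr ht).2.1, (hC r t hr ht).2.2.1⟩
  have hfire := hu.integrableOn_fire (cm := cm) hV2 hκ hcp.le ht
  have hmeas : MeasurableSet {r : ℝ | D.dEsc < ‖u r t‖} :=
    (isOpen_lt continuous_const (hu.continuous_r ht).norm).measurableSet
  have hψint : IntegrableOn (fun r => r ^ (m + 1) * cutoff κ cm cp r t) (Ioi 0) := by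
    refine integrableOn_of_pow_exp_bound (m := m) hκ (a := 0) (b := Real.exp (κ * cp * t))
      ((continuous_pow _).mul (continuous_cutoff t)).aestronglyMeasurable fun r hr => ?_
    rw [abs_of_pos (mul_pos (pow_pos hr _) (cutoff_pos r t))]
    calc r ^ (m + 1) * cutoff κ cm cp r t
        ≤ r ^ (m + 1) * (Real.exp (κ * cp * t) * Real.exp (-κ * r)) :=
          mul_le_mul_of_nonneg_left (cutoff_le hκ hcp.le le_rfl r) (pow_pos hr _).le
      _ = _ := by ring
  have hpoll : ∫ r in Sigma0 u D.dEsc t, psiSF (m + 2) κ cm cp r t =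
      ∫ r in Ioi (0:ℝ), {r : ℝ | D.dEsc < ‖u r t‖}.indicator
        (fun r => r ^ (m + 1) * cutoff κ cm cp r t) r := by
    rw [integral_indicator hmeas, Measure.restrict_restrict hmeas]
    have hset : (Sigma0 u D.dEsc t : Set ℝ) =ᵐ[volume]
        ({r : ℝ | D.dEsc < ‖u r t‖} ∩ Ioi 0 : Set ℝ) := by
      have heq : Sigma0 u D.dEsc t = {r : ℝ | D.dEsc < ‖u r t‖} ∩ Ici 0 := by
        ext r
        exact and_comm
      rw [heq]
      exact (ae_eq_refl _).inter Ioi_ae_eq_Ici.symm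
    rw [setIntegral_congr_set hset]
    exact integral_congr_ae
      (Eventually.of_forall fun r => psiSF_eq_cutoff (m + 2) hc ht.le r)
  have hmono := setIntegral_mono_on ((hInt.sub hdivint).add (hfire.const_mul ν))
    ((hψint.indicator hmeas).const_mul K) measurableSet_Ioi fun r hr => by
      have hr0 : (0:ℝ) < r := hr
      refine (fireRate_sub_divergence_le hu
        (neg_sq_div_four_le_wV_mul hV2 hcoerc D h0 hV0) hκ hcm hc hs1 hν1 ht hr0).trans ?_
      refine (mul_le_mul_of_nonneg_left (hK κ cp hκ hcp hs2 hs3 _ (huR r t hr0.le ht.le))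
        (mul_pos (pow_pos hr0 (m + 1)) (cutoff_pos r t)).le).trans (le_of_eq ?_)
      by_cases h : D.dEsc < ‖u r t‖
      · rw [if_pos h, indicator_of_mem (show r ∈ {r : ℝ | D.dEsc < ‖u r t‖} from h), mul_comm]
      · rw [if_neg h, indicator_of_notMem (show r ∉ {r : ℝ | D.dEsc < ‖u r t‖} from h)]
        simp
  simp only [Pi.add_apply] at hmono
  rw [integral_add (hInt.sub hdivint) (hfire.const_mul ν), integral_sub' hInt hdivint, hdiv,
    integral_const_mul, integral_const_mul, ← FSF_eq_cutoff hc ht.le, ← hpoll] at hmono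
  rw [hderiv.deriv]
  linarith
end
end

section
/- (Exponential decrease of pollution terms.) In the setting below, assume additionally that u satisfies (H_hom) with m = 0 and the non-invasion hypothesis (H_no_inv): c_Esc ≤ 0, and that c̃₊ < c_Hom. Then there exist positive quantities K and ε such that for every t > 0: ∫_{Σ₀(t)} ψ̃(r,t) dr ≤ K e^{−εt}. -/
open Filter Topology Set MeasureTheory

noncomputable section

local notation "⟪" x ", " y "⟫" => @inner ℝ _ _ x y

variable {n : ℕ}

/-- If the derivative of `f` tends to `c`, then `f` eventually grows faster than any slope below
`c`. -/
theorem eventually_mul_le_of_tendsto_deriv {f : ℝ → ℝ} {c a : ℝ}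
    (hf : ∀ t, DifferentiableAt ℝ f t) (hlim : Tendsto (deriv f) atTop (𝓝 c)) (ha : a < c) :
    ∀ᶠ t in atTop, a * t ≤ f t := by
  obtain ⟨b, hab, hbc⟩ := exists_between ha
  obtain ⟨T, hT⟩ := eventually_atTop.1 (hlim.eventually (lt_mem_nhds hbc))
  have hgrow : ∀ t ≥ T, b * (t - T) ≤ f t - f T := fun t ht =>
    (convex_Ici T).mul_sub_le_image_sub_of_le_deriv
      (fun x _ => (hf x).continuousAt.continuousWithinAt)
      (fun x _ => (hf x).differentiableWithinAt)
      (fun x hx => (hT x (interior_subset hx)).le) T self_mem_Ici t ht ht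
  filter_upwards [eventually_ge_atTop T, eventually_ge_atTop ((b * T - f T) / (b - a))]
    with t ht ht'
  have := hgrow t ht
  rw [div_le_iff₀ (by linarith)] at ht'
  linarith

/-- If the derivative of `f` tends to `c`, then `f` eventually grows slower than any slope above
`c`. -/
theorem eventually_le_mul_of_tendsto_deriv {f : ℝ → ℝ} {c a : ℝ}
    (hf : ∀ t, DifferentiableAt ℝ f t) (hlim : Tendsto (deriv f) atTop (𝓝 c)) (ha : c < a) :
    ∀ᶠ t in atTop, f t ≤ a * t := by
  have hlim' : Tendsto (deriv fun t => -f t) atTop (𝓝 (-c)) := by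
    have : (deriv fun t => -f t) = fun t => -deriv f t := funext fun t => deriv.fun_neg
    rw [this]
    exact hlim.neg
  filter_upwards [eventually_mul_le_of_tendsto_deriv (fun t => (hf t).neg) hlim'
    (neg_lt_neg ha)] with t ht
  rw [Pi.neg_apply] at ht
  linarith

theorem le_rEscF {u : ℝ → ℝ → Euc n} {m : Euc n} {δ t r : ℝ} {rHom : ℝ → ℝ}
    (hr : r ∈ rEscSet u m δ rHom t) : r ≤ rEscF u m δ rHom t :=
  le_csSup ⟨rHom t, fun _ hx => hx.1.2⟩ hr

theorem rEscF_le {u : ℝ → ℝ → Euc n} {m : Euc n} {δ t a : ℝ} {rHom : ℝ → ℝ}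
    (ha : rHom t ≤ a) (ha0 : 0 ≤ a) : rEscF u m δ rHom t ≤ a :=
  Real.sSup_le (fun _ hx => hx.1.2.trans ha) ha0

/-- Without invasion, the Escape point is eventually below any line of positive slope. -/
theorem eventually_rEscF_lt {u : ℝ → ℝ → Euc n} {m : Euc n} {δ cHom η : ℝ} {rHom : ℝ → ℝ}
    (hhom : HHomWith u m cHom rHom) (hnoinv : cEscV u m δ rHom ≤ 0) (hη : 0 < η) :
    ∀ᶠ t in atTop, rEscF u m δ rHom t < η * t := by
  obtain ⟨hc, hdiff, hlim, -⟩ := hhom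
  have hbdd : IsBoundedUnder (· ≤ ·) atTop fun t => rEscF u m δ rHom t / t := by
    refine isBoundedUnder_of_eventually_le (a := cHom + 1) ?_
    filter_upwards [eventually_le_mul_of_tendsto_deriv hdiff hlim (lt_add_one cHom),
      eventually_gt_atTop 0] with t ht ht0
    rw [div_le_iff₀ ht0]
    exact rEscF_le ht (by positivity)
  filter_upwards [eventually_lt_of_limsup_lt (lt_of_le_of_lt hnoinv hη) hbdd,
    eventually_gt_atTop 0] with t ht ht0
  rwa [div_lt_iff₀ ht0] at ht

theorem IsRadialSolution.continuous_u {d : ℕ} {V : Euc n → ℝ} {u : ℝ → ℝ → Euc n}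
    (hu : IsRadialSolution d V u) {t : ℝ} (ht : 0 < t) : Continuous fun r => u r t :=
  continuous_iff_continuousAt.2 fun r => (hu.diff_r t ht r).continuousAt

theorem IsRadialSolution.continuous_ur_s19 {d : ℕ} {V : Euc n → ℝ} {u : ℝ → ℝ → Euc n}
    (hu : IsRadialSolution d V u) {t : ℝ} (ht : 0 < t) : Continuous fun r => ur u r t :=
  continuous_iff_continuousAt.2 fun r => (hu.diff_rr t ht r).continuousAt

/-- The solution is eventually close to the equilibrium at the position `rHom t`. -/
theorem IsRadialSolution.eventually_norm_lt {d : ℕ} {V : Euc n → ℝ} {u : ℝ → ℝ → Euc n}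
    (hu : IsRadialSolution d V u) {m : Euc n} {cHom δ : ℝ} {rHom : ℝ → ℝ}
    (hhom : HHomWith u m cHom rHom) (hδ : 0 < δ) :
    ∀ᶠ t in atTop, ‖u (rHom t) t - m‖ < δ := by
  obtain ⟨hc, hdiff, hlim, hloc⟩ := hhom
  obtain ⟨C, hC⟩ := hu.bounded
  set B := max C 1
  have hB : 0 < B := lt_max_of_lt_right one_pos
  set s := min 1 (δ / (2 * B))
  have hs : 0 < s := lt_min one_pos (by positivity)
  have hs1 : s ≤ 1 := min_le_left _ _
  have hsB : B * s ≤ δ / 2 := by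
    calc B * s ≤ B * (δ / (2 * B)) := by gcongr; exact min_le_right _ _
      _ = δ / 2 := by field_simp
  have hpos : 0 < s * (δ / 2) ^ 2 := by positivity
  filter_upwards [(hloc 1 one_pos).eventually (gt_mem_nhds hpos), eventually_gt_atTop 0,
    eventually_mul_le_of_tendsto_deriv hdiff hlim hc] with t hint ht0 hrpos
  rw [zero_mul] at hrpos
  by_contra! hge
  have hlower : ∀ r ∈ Icc 0 s, δ / 2 ≤ ‖u (rHom t + r) t - m‖ := by
    intro r hr
    have hlip : ‖u (rHom t + r) t - u (rHom t) t‖ ≤ B * ‖rHom t + r - rHom t‖ := by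
      refine (convex_Ici (0 : ℝ)).norm_image_sub_le_of_norm_deriv_le
        (f := fun x => u x t) (fun x _ => hu.diff_r t ht0 x) (fun x hx => ?_) hrpos
        (add_nonneg hrpos hr.1)
      have := hC x t hx ht0
      have h1 := norm_nonneg (u x t)
      have h2 := norm_nonneg (urr u x t)
      have h3 := norm_nonneg (ut u x t)
      have h4 : ‖ur u x t‖ ≤ B := le_trans (by linarith) (le_max_left C 1)
      exact h4
    rw [add_sub_cancel_left, Real.norm_of_nonneg hr.1] at hlip
    have h1 : B * r ≤ B * s := mul_le_mul_of_nonneg_left hr.2 hB.le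
    have h2 := norm_sub_norm_le (u (rHom t) t - m) (u (rHom t + r) t - m)
    rw [sub_sub_sub_cancel_right, norm_sub_rev (u (rHom t) t) (u (rHom t + r) t)] at h2
    linarith
  have hcont : Continuous fun r =>
      ‖u (rHom t + r) t - m‖ ^ 2 + ‖ur u (rHom t + r) t‖ ^ 2 := by
    have h1 := (hu.continuous_u ht0).comp (continuous_const.add continuous_id : Continuous
      fun r => rHom t + r)
    have h2 := (hu.continuous_ur_s19 ht0).comp (continuous_const.add continuous_id : Continuous
      fun r => rHom t + r)
    exact ((h1.sub continuous_const).norm.pow 2).add (h2.norm.pow 2)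
  have hsub : ∫ r in (0 : ℝ)..s, (‖u (rHom t + r) t - m‖ ^ 2 + ‖ur u (rHom t + r) t‖ ^ 2) ≤
      ∫ r in (-1 : ℝ)..1, (‖u (rHom t + r) t - m‖ ^ 2 + ‖ur u (rHom t + r) t‖ ^ 2) :=
    intervalIntegral.integral_mono_interval (by norm_num) hs.le hs1
      (Eventually.of_forall fun r => by simp only [Pi.zero_apply]; positivity)
      (hcont.intervalIntegrable _ _)
  have hconst : ∫ _ in (0 : ℝ)..s, (δ / 2) ^ 2 ≤
      ∫ r in (0 : ℝ)..s, (‖u (rHom t + r) t - m‖ ^ 2 + ‖ur u (rHom t + r) t‖ ^ 2) := by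
    refine intervalIntegral.integral_mono_on hs.le intervalIntegrable_const
      (hcont.intervalIntegrable _ _) fun r hr => ?_
    have := pow_le_pow_left₀ (by positivity) (hlower r hr) 2
    have := sq_nonneg ‖ur u (rHom t + r) t‖
    linarith
  rw [intervalIntegral.integral_const, smul_eq_mul, sub_zero] at hconst
  linarith

/-- A point where the solution escapes lies either below the Escape point or beyond `rHom t`. -/
theorem le_rEscF_or_le_of_mem_Sigma0 {u : ℝ → ℝ → Euc n} {δ t r : ℝ} {rHom : ℝ → ℝ}
    (hcont : Continuous fun r => u r t) (hhom : ‖u (rHom t) t‖ < δ)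
    (hr : r ∈ Sigma0 u δ t) : r ≤ rEscF u 0 δ rHom t ∨ rHom t ≤ r := by
  refine or_iff_not_imp_right.2 fun hlt => ?_
  obtain ⟨x, hx, hxδ⟩ := intermediate_value_Icc' (not_le.1 hlt).le hcont.norm.continuousOn
    ⟨hhom.le, hr.2.le⟩
  refine hx.1.trans (le_rEscF ⟨⟨hr.1.trans hx.1, hx.2⟩, ?_⟩)
  simpa using hxδ

theorem psiSF_nonneg {d : ℕ} {κ cm cp r t : ℝ} (hr : 0 ≤ r) : 0 ≤ psiSF d κ cm cp r t := by
  unfold psiSF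
  split_ifs <;> positivity

/-- The weight `ψ̃` is controlled by any exponential dominating its three exponents. -/
theorem psiSF_le {d : ℕ} {κ cm cp r t b : ℝ} (hr : 0 ≤ r)
    (hleft : r ≤ cm * t → -κ * (cm * t - r) ≤ b)
    (hmid : cm * t < r → r ≤ cp * t → 0 ≤ b)
    (hright : cp * t < r → -κ * (r - cp * t) ≤ b) :
    psiSF d κ cm cp r t ≤ r ^ (d - 1) * Real.exp b := by
  have hpow : 0 ≤ r ^ (d - 1) := by positivity
  unfold psiSF
  split_ifs with h h'
  · exact mul_le_mul_of_nonneg_left (Real.exp_le_exp.2 (hleft h)) hpow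
  · exact le_mul_of_one_le_right hpow (Real.one_le_exp (hmid (not_le.1 h) h'))
  · exact mul_le_mul_of_nonneg_left (Real.exp_le_exp.2 (hright (not_le.1 h'))) hpow

theorem integrableOn_pow_mul_exp_neg_mul (j : ℕ) {b : ℝ} (hb : 0 < b) :
    IntegrableOn (fun r : ℝ => r ^ j * Real.exp (-b * r)) (Ici 0) := by
  rw [integrableOn_Ici_iff_integrableOn_Ioi]
  simpa using integrableOn_rpow_mul_exp_neg_mul_rpow (p := 1) (s := (j : ℝ))
    (by linarith [(Nat.cast_nonneg j : (0 : ℝ) ≤ j)]) one_pos hb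

theorem measurableSet_Sigma0 {u : ℝ → ℝ → Euc n} {δ t : ℝ}
    (hcont : Continuous fun r => u r t) : MeasurableSet (Sigma0 u δ t) :=
  measurableSet_Ici.inter (isOpen_lt continuous_const hcont.norm).measurableSet

/-- exponential decrease of pollution terms. -/
theorem stmt19 {n d k : ℕ} (hn : 1 ≤ n) (hd : 2 ≤ d) (hk : 2 ≤ k)
    (V : Euc n → ℝ) (hV : ContDiff ℝ (k : ℕ∞) V) (hcoerc : HCoerc V)
    (D : EscData n V) (h0 : (0 : Euc n) ∈ MinSet V) (hV0 : V 0 = 0)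
    (κ cm cp : ℝ) (hκ : 0 < κ) (hcm : 0 < cm) (hcmcp : cm ≤ cp)
    (h1 : κ * cp * wV V + wV V * κ ^ 2 + κ ≤ 1)
    (h2 : κ * cp * wV V ≤ D.lmin / (8 * D.lmax))
    (h3 : κ * (cp + 1) ≤ D.lmin / 4)
    (u : ℝ → ℝ → Euc n) (hu : IsRadialSolution d V u)
    (cHom : ℝ) (rHom : ℝ → ℝ) (hhom : HHomWith u 0 cHom rHom)
    (hnoinv : cEscV u 0 D.dEsc rHom ≤ 0)
    (hcp : cp < cHom) :
    ∃ K > (0:ℝ), ∃ ε > (0:ℝ), ∀ t > (0:ℝ),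
      (∫ r in Sigma0 u D.dEsc t, psiSF d κ cm cp r t) ≤ K * Real.exp (-ε * t) := by
  have hcp0 : 0 < cp := hcm.trans_le hcmcp
  obtain ⟨c, hc, hcH⟩ := exists_between hcp
  have hc0 : 0 < c := hcp0.trans hc
  -- `b` is the spatial decay rate left once the temporal decay rate `ε` has been extracted.
  set b := κ * (c - cp) / (2 * c) with hb_def
  have hb : 0 < b := div_pos (mul_pos hκ (by linarith)) (by linarith)
  have hbc : 2 * b * c = κ * (c - cp) := by rw [hb_def]; field_simp
  have hbκ : b ≤ κ := by
    rw [hb_def, div_le_iff₀ (by linarith)]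
    nlinarith
  set ε := min (κ * cm / 2) (b * c)
  have hε : 0 < ε := lt_min (by positivity) (by positivity)
  have hεm : ε ≤ κ * cm / 2 := min_le_left _ _
  have hεc : ε ≤ b * c := min_le_right _ _
  obtain ⟨T, hT⟩ := eventually_atTop.1 ((hu.eventually_norm_lt hhom D.dEsc_pos).and
    ((eventually_rEscF_lt hhom hnoinv (by linarith : 0 < cm / 4)).and
      (eventually_mul_le_of_tendsto_deriv hhom.2.1 hhom.2.2.1 hcH)))
  set A := (κ * cp + ε) * max T 0
  have hA : 0 ≤ A := by positivity
  set I := ∫ r in Ici (0 : ℝ), r ^ (d - 1) * Real.exp (-b * r)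
  have hI : 0 ≤ I := setIntegral_nonneg measurableSet_Ici fun r hr => by
    have : (0 : ℝ) ≤ r := hr
    positivity
  have hbound : ∀ t > 0, ∀ r ∈ Sigma0 u D.dEsc t,
      psiSF d κ cm cp r t ≤ r ^ (d - 1) * Real.exp (A - ε * t - b * r) := by
    intro t ht r hr
    have hr0 : 0 ≤ r := hr.1
    have hbr : b * r ≤ κ * r := mul_le_mul_of_nonneg_right hbκ hr0
    have hεt : ε * t ≤ κ * cm / 2 * t := mul_le_mul_of_nonneg_right hεm ht.le
    have hεct : ε * t ≤ b * c * t := mul_le_mul_of_nonneg_right hεc ht.le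
    have hcmt : cm * t ≤ cp * t := mul_le_mul_of_nonneg_right hcmcp ht.le
    by_cases htT : t < T
    · have hAt : (κ * cp + ε) * t ≤ A :=
        mul_le_mul_of_nonneg_left (htT.le.trans (le_max_left _ _)) (by positivity)
      refine psiSF_le hr0 (fun h => ?_) (fun _ h => ?_) (fun _ => ?_)
      · nlinarith
      · nlinarith
      · nlinarith
    · obtain ⟨hnorm, hEsc, hHom⟩ := hT t (not_lt.1 htT)
      rw [sub_zero] at hnorm
      rcases le_rEscF_or_le_of_mem_Sigma0 (hu.continuous_u ht) hnorm hr with h | h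
      · have hr4 : r ≤ cm / 4 * t := h.trans hEsc.le
        have hcmt0 : 0 < cm * t := mul_pos hcm ht
        refine psiSF_le hr0 (fun _ => ?_) (fun h' => ?_) (fun h' => ?_)
        · nlinarith
        · linarith
        · linarith
      · have hrc : c * t ≤ r := hHom.trans h
        have hct : cp * t < c * t := mul_lt_mul_of_pos_right hc ht
        refine psiSF_le hr0 (fun h' => ?_) (fun _ h' => ?_) (fun _ => ?_)
        · linarith
        · linarith
        · have h5 : (κ - b) * (c * t) ≤ (κ - b) * r :=
            mul_le_mul_of_nonneg_left hrc (by linarith)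
          have h6 : 2 * b * c * t = κ * (c - cp) * t := by rw [hbc]
          linarith
  refine ⟨Real.exp A * I + 1, by positivity, ε, hε, fun t ht => ?_⟩
  have hmeas := measurableSet_Sigma0 (δ := D.dEsc) (hu.continuous_u ht)
  have hsplit : (fun r : ℝ => r ^ (d - 1) * Real.exp (A - ε * t - b * r)) =
      fun r => Real.exp (A - ε * t) * (r ^ (d - 1) * Real.exp (-b * r)) := by
    funext r
    rw [sub_eq_add_neg (A - ε * t), Real.exp_add, neg_mul]
    ring
  have hint : IntegrableOn (fun r : ℝ => r ^ (d - 1) * Real.exp (A - ε * t - b * r)) (Ici 0) := by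
    rw [hsplit]
    exact (integrableOn_pow_mul_exp_neg_mul (d - 1) hb).const_mul _
  have hsubset : Sigma0 u D.dEsc t ⊆ Ici 0 := fun r hr => hr.1
  calc ∫ r in Sigma0 u D.dEsc t, psiSF d κ cm cp r t
      ≤ ∫ r in Sigma0 u D.dEsc t, r ^ (d - 1) * Real.exp (A - ε * t - b * r) :=
        integral_mono_of_nonneg
          (ae_restrict_of_forall_mem hmeas fun r hr => psiSF_nonneg hr.1)
          (hint.mono_set hsubset) (ae_restrict_of_forall_mem hmeas (hbound t ht))
    _ ≤ ∫ r in Ici (0 : ℝ), r ^ (d - 1) * Real.exp (A - ε * t - b * r) :=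
        setIntegral_mono_set hint
          (ae_restrict_of_forall_mem measurableSet_Ici fun r hr => by
            have : (0 : ℝ) ≤ r := hr
            simp only [Pi.zero_apply]
            positivity)
          hsubset.eventuallyLE
    _ = Real.exp A * I * Real.exp (-ε * t) := by
        rw [hsplit, integral_const_mul, sub_eq_add_neg, Real.exp_add, neg_mul]
        ring
    _ ≤ (Real.exp A * I + 1) * Real.exp (-ε * t) := by
        gcongr
        linarith
end
end
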